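/- arXiv:1504.05171 — 4 statements merged into one kernel-verified Lean document; each statement's English description precedes it below -/
import Mathlib

section
/- For all integers n, κ with 1 ≤ κ ≤ n, the C(n,κ)² sub-permanents perm_{R,C} (one for each pair of subsets R, C ⊆ {1,…,n} with |R| = |C| = κ) are linearly independent over ℂ; equivalently, the ℂ-linear span of all κ×κ sub-permanents inside the degree-κ homogeneous component S_κ has dimension C(n,κ)². -/
open MvPolynomial

/-- The sub-permanent `perm_{R,C}` of the generic `n × n` matrix `(x_{i,j})`, for row set `R`
and column set `C` of cardinality `κ`: the sum over all bijections `σ : R → C` of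
`∏_{i ∈ R} x_{i, σ(i)}` (bijections are parametrized by permutations of `Fin κ` composed with
the order-preserving enumerations of `R` and `C`). -/
noncomputable def subPerm {n κ : ℕ} {R C : Finset (Fin n)} (hR : R.card = κ) (hC : C.card = κ) :
    MvPolynomial (Fin n × Fin n) ℂ :=
  ∑ σ : Equiv.Perm (Fin κ), ∏ i : Fin κ,
    X ((R.orderIsoOfFin hR i : Fin n), (C.orderIsoOfFin hC (σ i) : Fin n))

theorem subPerm_eval_self {n κ : ℕ} {R C : Finset (Fin n)} (hR : R.card = κ) (hC : C.card = κ) :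
    eval (fun p : Fin n × Fin n => if p.1 ∈ R ∧ p.2 ∈ C then (1 : ℂ) else 0) (subPerm hR hC) ≠ 0 := by
  have h : eval (fun p : Fin n × Fin n => if p.1 ∈ R ∧ p.2 ∈ C then (1 : ℂ) else 0)
      (subPerm hR hC) = (κ.factorial : ℂ) := by
    unfold subPerm
    rw [map_sum]
    have : ∀ σ ∈ (Finset.univ : Finset (Equiv.Perm (Fin κ))),
        eval (fun p : Fin n × Fin n => if p.1 ∈ R ∧ p.2 ∈ C then (1 : ℂ) else 0)
        (∏ i : Fin κ, X ((R.orderIsoOfFin hR i : Fin n), (C.orderIsoOfFin hC (σ i) : Fin n)))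
          = 1 := by
      intro σ _
      rw [map_prod]
      apply Finset.prod_eq_one
      intro i _
      rw [eval_X, if_pos]
      exact ⟨(R.orderIsoOfFin hR i).2, (C.orderIsoOfFin hC (σ i)).2⟩
    rw [Finset.sum_congr rfl this]
    simp [Fintype.card_perm]
  rw [h]
  exact_mod_cast κ.factorial_ne_zero

theorem subPerm_eval_other {n κ : ℕ} {R C R' C' : Finset (Fin n)} (hR : R.card = κ)
    (hC : C.card = κ) (hR' : R'.card = κ) (hC' : C'.card = κ) (hne : ¬ (R = R' ∧ C = C')) :
    eval (fun p : Fin n × Fin n => if p.1 ∈ R' ∧ p.2 ∈ C' then (1 : ℂ) else 0)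
      (subPerm hR hC) = 0 := by
  unfold subPerm
  rw [map_sum]
  apply Finset.sum_eq_zero
  intro σ _
  rw [map_prod]
  by_contra h
  replace h := Finset.prod_ne_zero_iff.mp h
  have key : ∀ i : Fin κ, (R.orderIsoOfFin hR i : Fin n) ∈ R' ∧
      (C.orderIsoOfFin hC (σ i) : Fin n) ∈ C' := by
    intro i
    have := h i (Finset.mem_univ i)
    rw [eval_X] at this
    by_contra hc
    exact this (if_neg hc)
  apply hne
  constructor
  · apply Finset.eq_of_subset_of_card_le _ (by omega)
    intro x hx
    have := (key ((R.orderIsoOfFin hR).symm ⟨x, hx⟩)).1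
    simpa using this
  · apply Finset.eq_of_subset_of_card_le _ (by omega)
    intro x hx
    have := (key (σ.symm ((C.orderIsoOfFin hC).symm ⟨x, hx⟩))).2
    simpa using this

/-- For `1 ≤ κ ≤ n`, the `C(n,κ)²` sub-permanents of size `κ` of the generic `n × n` matrix are
linearly independent over `ℂ`; equivalently, their span inside the degree-`κ` component has
dimension `C(n,κ)²`. -/
theorem subPermanents_linearIndependent_and_span_dim (n κ : ℕ) (h1 : 1 ≤ κ) (h2 : κ ≤ n) :
    LinearIndependent ℂ
      (fun z : {z : Finset (Fin n) × Finset (Fin n) // z.1.card = κ ∧ z.2.card = κ} =>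
        subPerm z.2.1 z.2.2) ∧
    Module.finrank ℂ ↥(Submodule.span ℂ
      {p : MvPolynomial (Fin n × Fin n) ℂ |
        ∃ (R C : Finset (Fin n)) (hR : R.card = κ) (hC : C.card = κ), p = subPerm hR hC}) =
      n.choose κ ^ 2 := by
  have hli : LinearIndependent ℂ
      (fun z : {z : Finset (Fin n) × Finset (Fin n) // z.1.card = κ ∧ z.2.card = κ} =>
        subPerm z.2.1 z.2.2) := by
    rw [Fintype.linearIndependent_iff]
    intro g hg w
    have h := congrArg (eval (fun p : Fin n × Fin n =>
      if p.1 ∈ w.1.1 ∧ p.2 ∈ w.1.2 then (1 : ℂ) else 0)) hg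
    rw [map_sum, map_zero, Finset.sum_eq_single w, smul_eval] at h
    · exact (mul_eq_zero.mp h).resolve_right (subPerm_eval_self _ _)
    · intro z _ hz
      rw [smul_eval, subPerm_eval_other z.2.1 z.2.2 w.2.1 w.2.2, mul_zero]
      rintro ⟨ha, hb⟩
      exact hz (Subtype.ext (Prod.ext ha hb))
    · intro hw
      exact absurd (Finset.mem_univ w) hw
  refine ⟨hli, ?_⟩
  have hset : {p : MvPolynomial (Fin n × Fin n) ℂ |
        ∃ (R C : Finset (Fin n)) (hR : R.card = κ) (hC : C.card = κ), p = subPerm hR hC} =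
      Set.range (fun z : {z : Finset (Fin n) × Finset (Fin n) // z.1.card = κ ∧ z.2.card = κ} =>
        subPerm z.2.1 z.2.2) := by
    ext p
    constructor
    · rintro ⟨R, C, hR, hC, rfl⟩
      exact ⟨⟨(R, C), hR, hC⟩, rfl⟩
    · rintro ⟨z, rfl⟩
      exact ⟨_, _, z.2.1, z.2.2, rfl⟩
  rw [hset, finrank_span_eq_card hli, Fintype.card_of_subtype
    (Finset.powersetCard κ Finset.univ ×ˢ Finset.powersetCard κ Finset.univ)]
  · simp [sq]
  · intro z
    simp [Finset.mem_powersetCard]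
end

section
/- Let n ≥ 3 and let I = I^{perm_n,2} be the ideal of S generated by all 2×2 sub-permanents of the generic n×n matrix. Then for every integer t with 3 ≤ t ≤ n, the dimension of the degree-t component I_t = I ∩ S_t equals C(n²+t−1, t) − [ C(n,t)² + n² + (t−1)·(C(n²,2) − C(n,2)²) + 2·C(t−1,2)·(C(n,2)² + n·C(n,3)) + 2n·Σ_{j=3}^{t−1} C(t−1,j)·C(n,j+1) ]. -/
open MvPolynomial

/-- The ideal generated by all `κ × κ` sub-permanents of the generic `n × n` matrix. -/
noncomputable def permIdeal (n κ : ℕ) : Ideal (MvPolynomial (Fin n × Fin n) ℂ) :=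
  Ideal.span {p | ∃ (R C : Finset (Fin n)) (hR : R.card = κ) (hC : C.card = κ), p = subPerm hR hC}


abbrev Mon (n : ℕ) := (Fin n × Fin n) →₀ ℕ

noncomputable def ee {n : ℕ} (i j : Fin n) : Mon n := Finsupp.single (i, j) 1

noncomputable def rowM {n : ℕ} (m : Mon n) : Fin n →₀ ℕ := m.mapDomain Prod.fst
noncomputable def colM {n : ℕ} (m : Mon n) : Fin n →₀ ℕ := m.mapDomain Prod.snd

noncomputable def mm {n : ℕ} (m : Mon n) : MvPolynomial (Fin n × Fin n) ℂ := monomial m 1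

lemma mm_add {n : ℕ} (a b : Mon n) : mm (a + b) = mm a * mm b := by
  simp [mm, monomial_mul]

lemma mm_ee {n : ℕ} (i j : Fin n) : mm (ee i j) = X (i, j) := rfl

lemma rowM_add {n : ℕ} (a b : Mon n) : rowM (a + b) = rowM a + rowM b := Finsupp.mapDomain_add
lemma colM_add {n : ℕ} (a b : Mon n) : colM (a + b) = colM a + colM b := Finsupp.mapDomain_add
lemma rowM_ee {n : ℕ} (i j : Fin n) : rowM (ee i j) = Finsupp.single i 1 := by
  simp [rowM, ee]
lemma colM_ee {n : ℕ} (i j : Fin n) : colM (ee i j) = Finsupp.single j 1 := by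
  simp [colM, ee]
lemma rowM_deg {n : ℕ} (a : Mon n) : (rowM a).degree = a.degree := Finsupp.degree_mapDomain _ _
lemma colM_deg {n : ℕ} (a : Mon n) : (colM a).degree = a.degree := Finsupp.degree_mapDomain _ _

lemma rowM_apply {n : ℕ} (m : Mon n) (i : Fin n) : rowM m i = ∑ j, m (i, j) := by
  induction m using Finsupp.induction_linear with
  | zero => simp [rowM]
  | add f g hf hg => rw [rowM_add]; simp [hf, hg, Finset.sum_add_distrib]
  | single a b =>
    obtain ⟨p, q⟩ := a
    by_cases h : p = i
    · subst h; simp [rowM, Finsupp.single_apply]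
    · simp [rowM, Finsupp.single_apply, h]

lemma colM_apply {n : ℕ} (m : Mon n) (j : Fin n) : colM m j = ∑ i, m (i, j) := by
  induction m using Finsupp.induction_linear with
  | zero => simp [colM]
  | add f g hf hg => rw [colM_add]; simp [hf, hg, Finset.sum_add_distrib]
  | single a b =>
    obtain ⟨p, q⟩ := a
    by_cases h : q = j
    · subst h; simp [colM, Finsupp.single_apply]
    · simp [colM, Finsupp.single_apply, h]

lemma exists_split {n : ℕ} (m : Mon n) (i j : Fin n) (h : m (i, j) ≠ 0) :
    ∃ v, m = ee i j + v := by
  refine ⟨m - ee i j, ?_⟩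
  rw [add_tsub_cancel_of_le]
  rw [ee, Finsupp.single_le_iff]
  omega

lemma subPerm_two {n : ℕ} {R C : Finset (Fin n)} (hR : R.card = 2) (hC : C.card = 2) :
    ∃ p q a b : Fin n, p ≠ q ∧ a ≠ b ∧ R = {p, q} ∧ C = {a, b} ∧
      subPerm hR hC = X (p, a) * X (q, b) + X (p, b) * X (q, a) := by
  have key : ∀ (T : Finset (Fin n)) (hT : T.card = 2),
      ((T.orderIsoOfFin hT 0 : T) : Fin n) ≠ ((T.orderIsoOfFin hT 1 : T) : Fin n) ∧
      T = {((T.orderIsoOfFin hT 0 : T) : Fin n), ((T.orderIsoOfFin hT 1 : T) : Fin n)} := by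
    intro T hT
    have h1 : ((T.orderIsoOfFin hT 0 : T) : Fin n) ≠ ((T.orderIsoOfFin hT 1 : T) : Fin n) := by
      intro h
      have := (T.orderIsoOfFin hT).injective (Subtype.ext h)
      simp at this
    refine ⟨h1, ?_⟩
    symm
    apply Finset.eq_of_subset_of_card_le
    · intro x hx
      simp only [Finset.mem_insert, Finset.mem_singleton] at hx
      rcases hx with rfl | rfl <;> exact Subtype.property _
    · rw [Finset.card_pair h1, hT]
  refine ⟨_, _, _, _, (key R hR).1, (key C hC).1, (key R hR).2, (key C hC).2, ?_⟩
  have hu : (Finset.univ : Finset (Equiv.Perm (Fin 2))) = {1, Equiv.swap 0 1} := by decide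
  rw [subPerm, hu, Finset.sum_pair (by decide)]
  simp [Fin.prod_univ_two]

lemma gen_mem {n : ℕ} {i k j l : Fin n} (hik : i ≠ k) (hjl : j ≠ l) :
    mm (ee i j + ee k l) + mm (ee i l + ee k j) ∈ permIdeal n 2 := by
  have hR := Finset.card_pair hik
  have hC := Finset.card_pair hjl
  have h : subPerm hR hC ∈ permIdeal n 2 := Ideal.subset_span ⟨_, _, hR, hC, rfl⟩
  obtain ⟨p, q, a, b, hpq, hab, h1, h2, h3⟩ := subPerm_two hR hC
  rw [h3] at h
  simp only [mm_add, mm_ee]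
  have e1 : (i = p ∧ k = q) ∨ (i = q ∧ k = p) := by
    have := congrArg (fun T : Finset (Fin n) => (T : Set (Fin n))) h1
    simp only [Finset.coe_insert, Finset.coe_singleton] at this
    exact Set.pair_eq_pair_iff.1 this
  have e2 : (j = a ∧ l = b) ∨ (j = b ∧ l = a) := by
    have := congrArg (fun T : Finset (Fin n) => (T : Set (Fin n))) h2
    simp only [Finset.coe_insert, Finset.coe_singleton] at this
    exact Set.pair_eq_pair_iff.1 this
  rcases e1 with ⟨rfl, rfl⟩ | ⟨rfl, rfl⟩ <;> rcases e2 with ⟨rfl, rfl⟩ | ⟨rfl, rfl⟩ <;>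
    convert h using 1 <;> ring

/-- equality up to sign modulo the ideal -/
def Eqv {n : ℕ} (m m' : Mon n) : Prop :=
  mm m - mm m' ∈ permIdeal n 2 ∨ mm m + mm m' ∈ permIdeal n 2

lemma Eqv.refl {n : ℕ} (m : Mon n) : Eqv m m := Or.inl (by simp)

lemma Eqv.trans {n : ℕ} {a b c : Mon n} (h1 : Eqv a b) (h2 : Eqv b c) : Eqv a c := by
  rcases h1 with h1 | h1 <;> rcases h2 with h2 | h2
  · left; convert add_mem h1 h2 using 1; ring
  · right; convert add_mem h1 h2 using 1; ring
  · right; convert sub_mem h1 h2 using 1; ring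
  · left; convert sub_mem h1 h2 using 1; ring

lemma Eqv.add {n : ℕ} {a b : Mon n} (c : Mon n) (h : Eqv a b) : Eqv (c + a) (c + b) := by
  rcases h with h | h
  · left; convert Ideal.mul_mem_left _ (mm c) h using 1; rw [mm_add, mm_add]; ring
  · right; convert Ideal.mul_mem_left _ (mm c) h using 1; rw [mm_add, mm_add]; ring

lemma Eqv.mem {n : ℕ} {a b : Mon n} (h : Eqv a b) (hb : mm b ∈ permIdeal n 2) :
    mm a ∈ permIdeal n 2 := by
  rcases h with h | h
  · convert add_mem h hb using 1; ring
  · convert sub_mem h hb using 1; ring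

lemma pull {n : ℕ} (m : Mon n) (i j : Fin n) (hi : rowM m i ≠ 0) (hj : colM m j ≠ 0) :
    ∃ v, Eqv m (ee i j + v) ∧ rowM m = Finsupp.single i 1 + rowM v ∧
      colM m = Finsupp.single j 1 + colM v := by
  by_cases h : m (i, j) = 0
  · rw [rowM_apply] at hi
    rw [colM_apply] at hj
    obtain ⟨l, -, hl⟩ := Finset.exists_ne_zero_of_sum_ne_zero hi
    obtain ⟨k, -, hk⟩ := Finset.exists_ne_zero_of_sum_ne_zero hj
    have hlj : l ≠ j := by rintro rfl; exact hl h
    have hki : k ≠ i := by rintro rfl; exact hk h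
    obtain ⟨v, rfl⟩ := exists_split m i l hl
    have hk' : v (k, j) ≠ 0 := by
      simpa [ee, Finsupp.single_apply, hlj, hki.symm] using hk
    obtain ⟨w, rfl⟩ := exists_split v k j hk'
    refine ⟨ee k l + w, ?_, ?_, ?_⟩
    · have : Eqv (ee i l + ee k j) (ee i j + ee k l) := Or.inr (gen_mem hki.symm hlj)
      convert this.add w using 1 <;> abel
    · simp only [rowM_add, rowM_ee]
    · simp only [colM_add, colM_ee]; abel
  · obtain ⟨v, rfl⟩ := exists_split m i j h
    exact ⟨v, Eqv.refl _, by rw [rowM_add, rowM_ee], by rw [colM_add, colM_ee]⟩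

lemma eqv_of_margins {n : ℕ} : ∀ (d : ℕ) (m m' : Mon n), m'.degree = d → rowM m = rowM m' →
    colM m = colM m' → Eqv m m' := by
  intro d
  induction d with
  | zero =>
    intro m m' hd hr hc
    have h1 : m' = 0 := (Finsupp.degree_eq_zero_iff _).1 hd
    have h2 : m = 0 := by
      apply (Finsupp.degree_eq_zero_iff _).1
      rw [← rowM_deg, hr, rowM_deg, hd]
    rw [h1, h2]; exact Eqv.refl _
  | succ d ih =>
    intro m m' hd hr hc
    have hne : m' ≠ 0 := by
      rintro rfl
      simp at hd
    obtain ⟨⟨i, j⟩, hij⟩ := Finsupp.ne_iff.1 hne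
    obtain ⟨v', rfl⟩ := exists_split m' i j hij
    have hi : rowM m i ≠ 0 := by rw [hr, rowM_add, rowM_ee]; simp
    have hj : colM m j ≠ 0 := by rw [hc, colM_add, colM_ee]; simp
    obtain ⟨v, hv, hvr, hvc⟩ := pull m i j hi hj
    refine hv.trans (Eqv.add _ (ih v v' ?_ ?_ ?_))
    · rw [map_add, ee, Finsupp.degree_single] at hd; omega
    · rw [hvr, rowM_add, rowM_ee] at hr; exact add_left_cancel hr
    · rw [hvc, colM_add, colM_ee] at hc; exact add_left_cancel hc

lemma two_mem {n : ℕ} {p : MvPolynomial (Fin n × Fin n) ℂ} (h : p + p ∈ permIdeal n 2) :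
    p ∈ permIdeal n 2 := by
  have := Ideal.mul_mem_left _ (C (1/2 : ℂ)) h
  convert this using 1
  rw [← two_mul, ← mul_assoc, show (2 : MvPolynomial (Fin n × Fin n) ℂ) = C 2 from (map_ofNat C 2).symm, ← C_mul]
  norm_num

lemma tri_row {n : ℕ} {i k a b c : Fin n} (hik : i ≠ k) (hab : a ≠ b) (hac : a ≠ c) (hbc : b ≠ c) :
    mm (ee i a + (ee i b + ee k c)) ∈ permIdeal n 2 := by
  apply two_mem
  have h1 := Ideal.mul_mem_left _ (mm (ee i a)) (gen_mem hik hbc)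
  have h2 := Ideal.mul_mem_left _ (mm (ee i c)) (gen_mem hik hab)
  have h3 := Ideal.mul_mem_left _ (mm (ee i b)) (gen_mem hik hac)
  convert add_mem (sub_mem h1 h2) h3 using 1
  simp only [mm_add]; ring

lemma tri_col {n : ℕ} {i k a b c : Fin n} (hik : i ≠ k) (hab : a ≠ b) (hac : a ≠ c) (hbc : b ≠ c) :
    mm (ee a i + (ee b i + ee c k)) ∈ permIdeal n 2 := by
  apply two_mem
  have h1 := Ideal.mul_mem_left _ (mm (ee a i)) (gen_mem hbc hik)
  have h2 := Ideal.mul_mem_left _ (mm (ee c i)) (gen_mem hab hik)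
  have h3 := Ideal.mul_mem_left _ (mm (ee b i)) (gen_mem hac hik)
  convert add_mem (sub_mem h1 h2) h3 using 1
  simp only [mm_add]; ring

lemma bad_row {n : ℕ} {m : Mon n} {i k a b c : Fin n} (hik : i ≠ k) (hab : a ≠ b) (hac : a ≠ c)
    (hbc : b ≠ c) (hi : 2 ≤ rowM m i) (hk : rowM m k ≠ 0) (ha : colM m a ≠ 0)
    (hb : colM m b ≠ 0) (hc : colM m c ≠ 0) : mm m ∈ permIdeal n 2 := by
  obtain ⟨u, hu, ur, uc⟩ := pull m i a (by omega) ha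
  rw [ur] at hi hk
  rw [uc] at hb hc
  simp [hik, hab, hac, Finsupp.single_apply] at hi hk hb hc
  obtain ⟨v, hv, vr, vc⟩ := pull u i b (by omega) hb
  rw [vr] at hk
  rw [vc] at hc
  simp [hik, hbc, Finsupp.single_apply] at hk hc
  obtain ⟨w, hw, wr, wc⟩ := pull v k c hk hc
  refine hu.mem ((hv.add _).mem (((hw.add _).add _).mem ?_))
  have := Ideal.mul_mem_right (mm w) _ (tri_row hik hab hac hbc)
  convert this using 1
  simp only [mm_add]; ring

lemma bad_col {n : ℕ} {m : Mon n} {i k a b c : Fin n} (hik : i ≠ k) (hab : a ≠ b) (hac : a ≠ c)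
    (hbc : b ≠ c) (hi : 2 ≤ colM m i) (hk : colM m k ≠ 0) (ha : rowM m a ≠ 0)
    (hb : rowM m b ≠ 0) (hc : rowM m c ≠ 0) : mm m ∈ permIdeal n 2 := by
  obtain ⟨u, hu, ur, uc⟩ := pull m a i ha (by omega)
  rw [uc] at hi hk
  rw [ur] at hb hc
  simp [hik, hab, hac, Finsupp.single_apply] at hi hk hb hc
  obtain ⟨v, hv, vr, vc⟩ := pull u b i hb (by omega)
  rw [vc] at hk
  rw [vr] at hc
  simp [hik, hbc, Finsupp.single_apply] at hk hc
  obtain ⟨w, hw, wr, wc⟩ := pull v c k hc hk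
  refine hu.mem ((hv.add _).mem (((hw.add _).add _).mem ?_))
  have := Ideal.mul_mem_right (mm w) _ (tri_col hik hab hac hbc)
  convert this using 1
  simp only [mm_add]; ring

lemma deg_eq_card {n : ℕ} {r : Fin n →₀ ℕ} (h : ∀ i, r i ≤ 1) : r.degree = r.support.card := by
  rw [Finsupp.degree_apply, Finset.card_eq_sum_ones]
  refine Finset.sum_congr rfl fun i hi => ?_
  have := Finsupp.mem_support_iff.1 hi
  have := h i
  omega

lemma exists_table {n : ℕ} : ∀ (d : ℕ) (r c : Fin n →₀ ℕ), r.degree = d → c.degree = d →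
    ∃ m : Mon n, rowM m = r ∧ colM m = c := by
  intro d
  induction d with
  | zero =>
    intro r c hr hc
    rw [Finsupp.degree_eq_zero_iff] at hr hc
    exact ⟨0, by simp [rowM, hr], by simp [colM, hc]⟩
  | succ d ih =>
    intro r c hr hc
    have key : ∀ r : Fin n →₀ ℕ, r.degree = d + 1 → ∃ i r', r = Finsupp.single i 1 + r' ∧
        r'.degree = d := by
      intro r hr
      have hne : r ≠ 0 := by
        rintro rfl
        simp at hr
      obtain ⟨i, hi⟩ := Finsupp.ne_iff.1 hne
      have e : r = Finsupp.single i 1 + (r - Finsupp.single i 1) := by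
        rw [add_tsub_cancel_of_le]
        rw [Finsupp.single_le_iff]
        have : r i ≠ 0 := hi
        omega
      refine ⟨i, _, e, ?_⟩
      rw [e, map_add, Finsupp.degree_single] at hr
      omega
    obtain ⟨i, r', rfl, hr'⟩ := key r hr
    obtain ⟨j, c', rfl, hc'⟩ := key c hc
    obtain ⟨m, h1, h2⟩ := ih r' c' hr' hc'
    exact ⟨ee i j + m, by rw [rowM_add, rowM_ee, h1], by rw [colM_add, colM_ee, h2]⟩

/-- sign functions -/
def IsSign {n : ℕ} (s : Mon n → ℂ) (r c : Fin n →₀ ℕ) : Prop :=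
  (∀ u i k j l, i ≠ k → j ≠ l → s (u + (ee i j + ee k l)) + s (u + (ee i l + ee k j)) = 0) ∧
  (∀ m, s m ≠ 0 → rowM m = r ∧ colM m = c) ∧ ∃ m, s m ≠ 0

lemma mkSign {n : ℕ} {r c : Fin n →₀ ℕ} (g : Mon n → ℂ)
    (hg : ∀ u i k j l, i ≠ k → j ≠ l → rowM (u + (ee i j + ee k l)) = r →
      colM (u + (ee i j + ee k l)) = c →
      g (u + (ee i j + ee k l)) + g (u + (ee i l + ee k j)) = 0)
    (m0 : Mon n) (h1 : rowM m0 = r) (h2 : colM m0 = c) (h0 : g m0 ≠ 0) :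
    ∃ s, IsSign s r c := by
  classical
  refine ⟨fun m => if rowM m = r ∧ colM m = c then g m else 0, ?_, ?_, m0, ?_⟩
  · intro u i k j l hik hjl
    have e1 : rowM (u + (ee i l + ee k j)) = rowM (u + (ee i j + ee k l)) := by
      simp only [rowM_add, rowM_ee]
    have e2 : colM (u + (ee i l + ee k j)) = colM (u + (ee i j + ee k l)) := by
      simp only [colM_add, colM_ee]; abel
    simp only [e1, e2]
    split_ifs with h
    · exact hg u i k j l hik hjl h.1 h.2
    · simp
  · intro m hm
    by_contra h
    simp [h] at hm
  · simp [h1, h2, h0]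

lemma sign_row {n : ℕ} {r c : Fin n →₀ ℕ} (hd : r.degree = c.degree) (h : r.support.card = 1) :
    ∃ s, IsSign s r c := by
  obtain ⟨m, h1, h2⟩ := exists_table _ r c rfl hd.symm
  refine mkSign (fun _ => 1) ?_ m h1 h2 one_ne_zero
  intro u i k j l hik hjl hr hc
  exfalso
  obtain ⟨p, hp⟩ := Finset.card_eq_one.1 h
  have hi : i ∈ r.support := by
    rw [Finsupp.mem_support_iff, ← hr]; simp [rowM_add, rowM_ee]
  have hk : k ∈ r.support := by
    rw [Finsupp.mem_support_iff, ← hr]; simp [rowM_add, rowM_ee]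
  rw [hp, Finset.mem_singleton] at hi hk
  exact hik (hi.trans hk.symm)

lemma sign_col {n : ℕ} {r c : Fin n →₀ ℕ} (hd : r.degree = c.degree) (h : c.support.card = 1) :
    ∃ s, IsSign s r c := by
  obtain ⟨m, h1, h2⟩ := exists_table _ r c rfl hd.symm
  refine mkSign (fun _ => 1) ?_ m h1 h2 one_ne_zero
  intro u i k j l hik hjl hr hc
  exfalso
  obtain ⟨p, hp⟩ := Finset.card_eq_one.1 h
  have hi : j ∈ c.support := by
    rw [Finsupp.mem_support_iff, ← hc]; simp [colM_add, colM_ee]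
  have hk : l ∈ c.support := by
    rw [Finsupp.mem_support_iff, ← hc]; simp [colM_add, colM_ee]
  rw [hp, Finset.mem_singleton] at hi hk
  exact hjl (hi.trans hk.symm)

lemma sign_two {n : ℕ} {r c : Fin n →₀ ℕ} (hd : r.degree = c.degree) (h : r.support.card = 2)
    (h' : c.support.card = 2) : ∃ s, IsSign s r c := by
  obtain ⟨m, h1, h2⟩ := exists_table _ r c rfl hd.symm
  obtain ⟨p, q, hpq, hp⟩ := Finset.card_eq_two.1 h
  obtain ⟨a, b, hab, ha⟩ := Finset.card_eq_two.1 h'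
  refine mkSign (fun m => (-1) ^ (m (p, a))) ?_ m h1 h2 (by simp)
  intro u i k j l hik hjl hr hc
  have hi : i ∈ r.support := by
    rw [Finsupp.mem_support_iff, ← hr]; simp [rowM_add, rowM_ee]
  have hk : k ∈ r.support := by
    rw [Finsupp.mem_support_iff, ← hr]; simp [rowM_add, rowM_ee]
  have hj : j ∈ c.support := by
    rw [Finsupp.mem_support_iff, ← hc]; simp [colM_add, colM_ee]
  have hl : l ∈ c.support := by
    rw [Finsupp.mem_support_iff, ← hc]; simp [colM_add, colM_ee]
  simp only [hp, ha, Finset.mem_insert, Finset.mem_singleton] at hi hk hj hl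
  rcases hi with rfl | rfl <;> rcases hk with rfl | rfl <;> rcases hj with rfl | rfl <;>
    rcases hl with rfl | rfl <;> first
    | exact absurd rfl hik
    | exact absurd rfl hjl
    | (simp [ee, Finsupp.single_apply, hik, hjl, hik.symm, hjl.symm, pow_succ])

lemma sum_single_emb {n t : ℕ} {r : Fin n →₀ ℕ} (h : ∀ i, r i ≤ 1) (ht : r.support.card = t) :
    ∑ x : Fin t, Finsupp.single (r.support.orderEmbOfFin ht x) 1 = r := by
  ext i
  rw [Finsupp.finset_sum_apply]
  by_cases hi : i ∈ r.support
  · have : i ∈ Set.range (r.support.orderEmbOfFin ht) := by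
      rw [Finset.range_orderEmbOfFin]; exact hi
    obtain ⟨y, rfl⟩ := this
    rw [Finset.sum_eq_single y]
    · have := h (r.support.orderEmbOfFin ht y)
      have := Finsupp.mem_support_iff.1 hi
      rw [Finsupp.single_eq_same]
      omega
    · intro z _ hz
      rw [Finsupp.single_apply, if_neg]
      simpa using hz
    · simp
  · rw [Finsupp.notMem_support_iff.1 hi]
    apply Finset.sum_eq_zero
    intro x _
    rw [Finsupp.single_apply, if_neg]
    rintro rfl
    exact hi (Finset.orderEmbOfFin_mem _ _ _)

lemma sign_perm {n t : ℕ} {r c : Fin n →₀ ℕ} (hr : r.degree = t) (hc : c.degree = t)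
    (h : ∀ i, r i ≤ 1) (h' : ∀ i, c i ≤ 1) : ∃ s, IsSign s r c := by
  classical
  have hrt : r.support.card = t := by rw [← deg_eq_card h, hr]
  have hct : c.support.card = t := by rw [← deg_eq_card h', hc]
  set ρ := r.support.orderEmbOfFin hrt with hρ
  set γ := c.support.orderEmbOfFin hct with hγ
  refine mkSign (fun m => Matrix.det (Matrix.of fun x y : Fin t => (m (ρ x, γ y) : ℂ))) ?_
    (∑ x : Fin t, ee (ρ x) (γ x)) ?_ ?_ ?_
  · intro u i k j l hik hjl er ec
    have hi : i ∈ Set.range ρ := by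
      rw [hρ, Finset.range_orderEmbOfFin, Finset.mem_coe, Finsupp.mem_support_iff, ← er]
      simp [rowM_add, rowM_ee]
    have hk : k ∈ Set.range ρ := by
      rw [hρ, Finset.range_orderEmbOfFin, Finset.mem_coe, Finsupp.mem_support_iff, ← er]
      simp [rowM_add, rowM_ee]
    have hui : rowM u i = 0 := by
      have := h i
      rw [← er, rowM_add, rowM_add, rowM_ee, rowM_ee] at this
      simp at this
      omega
    have huk : rowM u k = 0 := by
      have := h k
      rw [← er, rowM_add, rowM_add, rowM_ee, rowM_ee] at this
      simp at this
      omega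
    rw [rowM_apply, Finset.sum_eq_zero_iff] at hui huk
    obtain ⟨x, rfl⟩ := hi
    obtain ⟨y, rfl⟩ := hk
    have hxy : x ≠ y := by rintro rfl; exact hik rfl
    have hM : (Matrix.of fun x' y' : Fin t =>
        ((u + (ee (ρ x) l + ee (ρ y) j)) (ρ x', γ y') : ℂ)) =
        (Matrix.of fun x' y' : Fin t =>
        ((u + (ee (ρ x) j + ee (ρ y) l)) (ρ x', γ y') : ℂ)).submatrix (Equiv.swap x y) id := by
      ext z w
      simp only [Matrix.of_apply, Matrix.submatrix_apply, id]
      by_cases hzx : z = x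
      · subst hzx
        rw [Equiv.swap_apply_left]
        simp [ee, Finsupp.single_apply, hxy, hxy.symm, hui, huk]
      · by_cases hzy : z = y
        · subst hzy
          rw [Equiv.swap_apply_right]
          simp [ee, Finsupp.single_apply, hxy, hxy.symm, hui, huk]
        · rw [Equiv.swap_apply_of_ne_of_ne hzx hzy]
          simp [ee, Finsupp.single_apply, Ne.symm hzx, Ne.symm hzy]
    show Matrix.det _ + Matrix.det _ = 0
    rw [hM, Matrix.det_permute, Equiv.Perm.sign_swap hxy]
    simp
  · rw [rowM, Finsupp.mapDomain_finset_sum, ← sum_single_emb h hrt]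
    simp [ee, hρ]
  · rw [colM, Finsupp.mapDomain_finset_sum, ← sum_single_emb h' hct]
    simp [ee, hγ]
  · have : (Matrix.of fun x y : Fin t => ((∑ x : Fin t, ee (ρ x) (γ x)) (ρ x, γ y) : ℂ)) = 1 := by
      ext x y
      rw [Matrix.of_apply, Finsupp.finset_sum_apply]
      by_cases hxy : x = y
      · subst hxy
        rw [Finset.sum_eq_single x]
        · simp [ee]
        · intro z _ hz; simp [ee, hz]
        · simp
      · rw [Finset.sum_eq_zero]
        · simp [Matrix.one_apply, hxy]
        · intro z _
          simp only [ee, Finsupp.single_apply, Prod.mk.injEq, EmbeddingLike.apply_eq_iff_eq]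
          rw [if_neg]
          rintro ⟨rfl, rfl⟩; exact hxy rfl
    show Matrix.det _ ≠ 0
    rw [this]; simp

/-- margin vectors of degree t -/
noncomputable def AA (n t : ℕ) : Finset (Fin n →₀ ℕ) := Finset.finsuppAntidiag Finset.univ t

lemma mem_AA {n t : ℕ} {r : Fin n →₀ ℕ} : r ∈ AA n t ↔ r.degree = t := by
  simp [AA, Finsupp.degree_eq_sum]

noncomputable def AS (n t k : ℕ) : Finset (Fin n →₀ ℕ) := (AA n t).filter fun r => r.support.card = k

open Classical in
noncomputable def AP (n t : ℕ) : Finset (Fin n →₀ ℕ) := (AA n t).filter fun r => ∀ i, r i ≤ 1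

open Classical in
noncomputable def BB (n t : ℕ) : Finset ((Fin n →₀ ℕ) × (Fin n →₀ ℕ)) :=
  ((AS n t 1 ×ˢ AA n t) ∪ (AA n t ×ˢ AS n t 1)) ∪ ((AS n t 2 ×ˢ AS n t 2) ∪ (AP n t ×ˢ AP n t))

lemma mem_BB {n t : ℕ} {r c : Fin n →₀ ℕ} : (r, c) ∈ BB n t ↔ r.degree = t ∧ c.degree = t ∧
    (r.support.card = 1 ∨ c.support.card = 1 ∨ (r.support.card = 2 ∧ c.support.card = 2) ∨
      ((∀ i, r i ≤ 1) ∧ ∀ i, c i ≤ 1)) := by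
  simp only [BB, AS, AP, Finset.mem_union, Finset.mem_product, Finset.mem_filter, mem_AA]
  tauto

lemma good_sign {n t : ℕ} {r c : Fin n →₀ ℕ} (h : (r, c) ∈ BB n t) : ∃ s, IsSign s r c := by
  obtain ⟨hr, hc, h | h | h | h⟩ := mem_BB.1 h
  · exact sign_row (hr.trans hc.symm) h
  · exact sign_col (hr.trans hc.symm) h
  · exact sign_two (hr.trans hc.symm) h.1 h.2
  · exact sign_perm hr hc h.1 h.2

lemma bad_mem {n t : ℕ} (ht : 3 ≤ t) {m : Mon n} (hd : m.degree = t)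
    (h : (rowM m, colM m) ∉ BB n t) : mm m ∈ permIdeal n 2 := by
  have hr : (rowM m).degree = t := by rw [rowM_deg, hd]
  have hc : (colM m).degree = t := by rw [colM_deg, hd]
  rw [mem_BB] at h
  simp only [hr, hc, true_and, not_or] at h
  obtain ⟨h1, h2, h3, h4⟩ := h
  have pos : ∀ r : Fin n →₀ ℕ, r.degree = t → r.support.card ≠ 0 := by
    intro r hr h0
    rw [Finset.card_eq_zero, Finsupp.support_eq_empty] at h0
    subst h0
    simp at hr
    omega
  have p1 := pos _ hr
  have p2 := pos _ hc
  by_cases c1 : (∃ i, 2 ≤ rowM m i) ∧ 2 < (colM m).support.card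
  · obtain ⟨⟨i, hi⟩, hcc⟩ := c1
    obtain ⟨a, ha, b, hb, c, hc', hab, hac, hbc⟩ := Finset.two_lt_card.1 hcc
    obtain ⟨k, hk, hki⟩ := Finset.exists_mem_ne (s := (rowM m).support) (by omega) i
    rw [Finsupp.mem_support_iff] at ha hb hc' hk
    exact bad_row hki.symm hab hac hbc hi hk ha hb hc'
  by_cases c2 : (∃ i, 2 ≤ colM m i) ∧ 2 < (rowM m).support.card
  · obtain ⟨⟨i, hi⟩, hcc⟩ := c2
    obtain ⟨a, ha, b, hb, c, hc', hab, hac, hbc⟩ := Finset.two_lt_card.1 hcc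
    obtain ⟨k, hk, hki⟩ := Finset.exists_mem_ne (s := (colM m).support) (by omega) i
    rw [Finsupp.mem_support_iff] at ha hb hc' hk
    exact bad_col hki.symm hab hac hbc hi hk ha hb hc'
  exfalso
  have q : ∀ r : Fin n →₀ ℕ, r.degree = t → (¬ ∃ i, 2 ≤ r i) → (∀ i, r i ≤ 1) ∧ r.support.card = t := by
    intro r hr h
    have : ∀ i, r i ≤ 1 := by
      intro i
      by_contra h'
      exact h ⟨i, by omega⟩
    exact ⟨this, by rw [← deg_eq_card this, hr]⟩
  have q1 := q _ hr
  have q2 := q _ hc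
  by_cases d1 : ∃ i, 2 ≤ rowM m i <;> by_cases d2 : ∃ i, 2 ≤ colM m i
  · simp only [d1, d2, true_and] at c1 c2
    exact h3 ⟨by omega, by omega⟩
  · have := (q2 d2).2
    simp only [d1, true_and] at c1
    omega
  · have := (q1 d1).2
    simp only [d2, true_and] at c2
    omega
  · exact h4 ⟨(q1 d1).1, (q2 d2).1⟩

lemma card_AA (n t : ℕ) : (AA n t).card = (n + t - 1).choose t := by
  rw [AA, Finset.card_finsuppAntidiag_nat_eq_choose]; simp

lemma card_AS_one (n t : ℕ) (ht : t ≠ 0) : (AS n t 1).card = n := by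
  have : AS n t 1 = Finset.univ.image (fun i : Fin n => Finsupp.single i t) := by
    ext r
    simp only [AS, Finset.mem_filter, mem_AA, Finset.mem_image, Finset.mem_univ, true_and]
    constructor
    · rintro ⟨h1, h2⟩
      obtain ⟨a, -, h⟩ := Finsupp.card_support_eq_one.1 h2
      refine ⟨a, ?_⟩
      rw [h, Finsupp.degree_single] at h1
      rw [h, ← h1]
    · rintro ⟨i, rfl⟩
      exact ⟨Finsupp.degree_single _ _, by rw [Finsupp.support_single _ ht]; simp⟩
  rw [this, Finset.card_image_of_injective]
  · simp
  · exact Finsupp.single_left_injective ht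

lemma card_AS_two (n t : ℕ) : (AS n t 2).card = n.choose 2 * (t - 1) := by
  classical
  rw [Finset.card_eq_sum_card_fiberwise (f := fun r : Fin n →₀ ℕ => r.support)
    (t := Finset.powersetCard 2 Finset.univ)]
  · rw [Finset.sum_const_nat (m := t - 1)]
    · simp
    intro S hS
    rw [Finset.mem_powersetCard] at hS
    obtain ⟨p, q, hpq, rfl⟩ := Finset.card_eq_two.1 hS.2
    have : (AS n t 2).filter (fun r => r.support = {p, q}) =
        (Finset.Icc 1 (t - 1)).image
          (fun a => (Finsupp.single p a + Finsupp.single q (t - a) : Fin n →₀ ℕ)) := by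
      ext r
      simp only [AS, Finset.mem_filter, mem_AA, Finset.mem_image, Finset.mem_Icc]
      constructor
      · rintro ⟨⟨h1, h2⟩, h3⟩
        have hp : p ∈ r.support := by simp [h3]
        have hq : q ∈ r.support := by simp [h3]
        rw [Finsupp.degree_apply, h3, Finset.sum_pair hpq] at h1
        rw [Finsupp.mem_support_iff] at hp hq
        refine ⟨r p, by omega, ?_⟩
        ext i
        by_cases hip : i = p
        · subst hip; simp [hpq]
        by_cases hiq : i = q
        · subst hiq; simp [hpq]; omega
        have : i ∉ r.support := by simp [h3, hip, hiq]
        rw [Finsupp.notMem_support_iff] at this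
        simp [this, Ne.symm hip, Ne.symm hiq]
      · rintro ⟨a, ha, rfl⟩
        have hs : (Finsupp.single p a + Finsupp.single q (t - a) : Fin n →₀ ℕ).support = {p, q} := by
          ext i
          by_cases hip : i = p
          · subst hip; simp [hpq]; omega
          by_cases hiq : i = q
          · subst hiq; simp [hpq]; omega
          simp [hip, hiq, Ne.symm hip, Ne.symm hiq]
        rw [hs]
        refine ⟨⟨?_, Finset.card_pair hpq⟩, rfl⟩
        rw [map_add, Finsupp.degree_single, Finsupp.degree_single]; omega
    rw [this, Finset.card_image_of_injective]
    · simp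
    · intro a b hab
      have := DFunLike.congr_fun hab p
      simpa [hpq] using this
  · intro r hr
    have hr' : r ∈ AS n t 2 := hr
    rw [AS, Finset.mem_filter] at hr'
    simp [hr'.2]

lemma card_AP (n t : ℕ) : (AP n t).card = n.choose t := by
  classical
  have : (Finset.powersetCard t (Finset.univ : Finset (Fin n))).card = n.choose t := by simp
  rw [← this]
  refine Finset.card_bij (fun r _ => r.support) ?_ ?_ ?_
  · intro r hr
    simp only [AP, Finset.mem_filter, mem_AA] at hr
    simp [← deg_eq_card hr.2, hr.1]
  · intro r hr r' hr' h
    simp only [AP, Finset.mem_filter, mem_AA] at hr hr'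
    ext i
    have h1 := hr.2 i
    have h2 := hr'.2 i
    have h3 : i ∈ r.support ↔ i ∈ r'.support := by rw [h]
    simp only [Finsupp.mem_support_iff] at h3
    omega
  · intro S hS
    rw [Finset.mem_powersetCard] at hS
    have hs : (Finsupp.indicator S (fun _ _ => 1) : Fin n →₀ ℕ).support = S := by
      ext i; simp [Finsupp.indicator_apply]
    have hl : ∀ i, (Finsupp.indicator S (fun _ _ => 1) : Fin n →₀ ℕ) i ≤ 1 := by
      intro i
      rw [Finsupp.indicator_apply]; split_ifs <;> simp
    refine ⟨_, ?_, hs⟩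
    simp only [AP, Finset.mem_filter, mem_AA]
    exact ⟨by rw [deg_eq_card hl, hs, hS.2], hl⟩

lemma card_BB (n t : ℕ) (ht : 3 ≤ t) : (BB n t).card + n ^ 2 =
    2 * n * (n + t - 1).choose t + (n.choose 2 * (t - 1)) ^ 2 + n.choose t ^ 2 := by
  classical
  have sub1 : AS n t 1 ⊆ AA n t := Finset.filter_subset _ _
  have hAP : ∀ r ∈ AP n t, r.support.card = t := by
    intro r hr
    simp only [AP, Finset.mem_filter, mem_AA] at hr
    rw [← deg_eq_card hr.2, hr.1]
  have hAS : ∀ k, ∀ r ∈ AS n t k, r.support.card = k := by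
    intro k r hr
    exact (Finset.mem_filter.1 hr).2
  have d1 : Disjoint (AS n t 2 ×ˢ AS n t 2) (AP n t ×ˢ AP n t) := by
    rw [Finset.disjoint_left]
    intro x hx hx'
    rw [Finset.mem_product] at hx hx'
    have := hAP _ hx'.1
    have := hAS _ _ hx.1
    omega
  have d2 : Disjoint ((AS n t 1 ×ˢ AA n t) ∪ (AA n t ×ˢ AS n t 1))
      ((AS n t 2 ×ˢ AS n t 2) ∪ (AP n t ×ˢ AP n t)) := by
    rw [Finset.disjoint_left]
    intro x hx hx'
    simp only [Finset.mem_union, Finset.mem_product] at hx hx'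
    rcases hx with hx | hx <;> rcases hx' with hx' | hx'
    · have := hAS _ _ hx.1
      have := hAS _ _ hx'.1
      omega
    · have := hAS _ _ hx.1
      have := hAP _ hx'.1
      omega
    · have := hAS _ _ hx.2
      have := hAS _ _ hx'.2
      omega
    · have := hAS _ _ hx.2
      have := hAP _ hx'.2
      omega
  have hi : (AS n t 1 ×ˢ AA n t) ∩ (AA n t ×ˢ AS n t 1) = AS n t 1 ×ˢ AS n t 1 := by
    rw [Finset.product_inter_product, Finset.inter_eq_left.2 sub1, Finset.inter_eq_right.2 sub1]
  have hu := Finset.card_union_add_card_inter (AS n t 1 ×ˢ AA n t) (AA n t ×ˢ AS n t 1)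
  rw [hi] at hu
  have e : (BB n t).card = ((AS n t 1 ×ˢ AA n t) ∪ (AA n t ×ˢ AS n t 1)).card +
      ((AS n t 2 ×ˢ AS n t 2).card + (AP n t ×ˢ AP n t).card) := by
    rw [BB]
    convert Finset.card_union_of_disjoint d2 using 2
    exact (Finset.card_union_of_disjoint d1).symm
  simp only [Finset.card_product, card_AS_one n t (by omega), card_AS_two, card_AA, card_AP] at hu e
  rw [e]
  linarith [hu]

lemma vandermonde (n s : ℕ) (hs : 2 ≤ s) : (n + s).choose (s + 1) =
    n + s * n.choose 2 + s.choose 2 * n.choose 3 +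
      ∑ j ∈ Finset.Icc 3 s, s.choose j * n.choose (j + 1) := by
  have h1 : (n + s).choose (s + 1) = ∑ j ∈ Finset.range (s + 1), s.choose j * n.choose (j + 1) := by
    rw [Nat.add_choose_eq, Finset.Nat.sum_antidiagonal_eq_sum_range_succ_mk, Finset.sum_range_succ']
    simp only [Nat.sub_zero, Nat.choose_succ_self, mul_zero, add_zero]
    refine Finset.sum_congr rfl fun j hj => ?_
    rw [Finset.mem_range] at hj
    rw [Nat.add_sub_add_right, Nat.choose_symm (by omega), mul_comm]
  rw [h1, Finset.range_eq_Ico, ← Finset.sum_Ico_consecutive _ (Nat.zero_le 3) (by omega)]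
  rw [← Finset.range_eq_Ico]
  simp [Finset.sum_range_succ]
  rfl

lemma hom_span (n t : ℕ) : homogeneousSubmodule (Fin n × Fin n) ℂ t =
    Submodule.span ℂ (Set.range (fun m : {m : Mon n // m ∈
      (Finset.finsuppAntidiag Finset.univ t : Finset (Mon n))} => (mm (m : Mon n)))) := by
  classical
  apply le_antisymm
  · intro f hf
    rw [f.as_sum]
    refine Submodule.sum_mem _ fun m hm => ?_
    have : monomial m (coeff m f) = coeff m f • mm m := by
      simp [mm, smul_monomial]
    rw [this]
    refine Submodule.smul_mem _ _ (Submodule.subset_span ⟨⟨m, ?_⟩, rfl⟩)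
    have hd : m.degree = t := by
      rw [Finsupp.degree_eq_weight_one]
      exact hf (mem_support_iff.1 hm)
    simpa [Finsupp.degree_eq_sum] using hd
  · rw [Submodule.span_le]
    rintro _ ⟨⟨m, hm⟩, rfl⟩
    refine isHomogeneous_monomial _ ?_
    simpa [Finsupp.degree_eq_sum] using hm

lemma finrank_hom (n t : ℕ) : Module.finrank ℂ (homogeneousSubmodule (Fin n × Fin n) ℂ t) =
    (n ^ 2 + t - 1).choose t := by
  classical
  have li : LinearIndependent ℂ (fun m : {m : Mon n // m ∈
      (Finset.finsuppAntidiag Finset.univ t : Finset (Mon n))} => (mm (m : Mon n))) := by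
    have e : (fun m : {m : Mon n // m ∈
      (Finset.finsuppAntidiag Finset.univ t : Finset (Mon n))} => (mm (m : Mon n))) =
        (basisMonomials (Fin n × Fin n) ℂ) ∘ Subtype.val := by
      funext m
      simp [mm]
    rw [e]
    exact (basisMonomials (Fin n × Fin n) ℂ).linearIndependent.comp _ Subtype.val_injective
  rw [hom_span, finrank_span_eq_card li, Fintype.card_coe,
    Finset.card_finsuppAntidiag_nat_eq_choose]
  simp [sq]

noncomputable def phi {n : ℕ} (s : Mon n → ℂ) : MvPolynomial (Fin n × Fin n) ℂ →ₗ[ℂ] ℂ :=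
  (basisMonomials (Fin n × Fin n) ℂ).constr ℂ s

lemma phi_mm {n : ℕ} (s : Mon n → ℂ) (m : Mon n) : phi s (mm m) = s m := by
  have := (basisMonomials (Fin n × Fin n) ℂ).constr_basis ℂ s m
  simpa [phi, mm] using this

lemma phi_ideal {n : ℕ} {s : Mon n → ℂ} {r c : Fin n →₀ ℕ} (hs : IsSign s r c)
    {p : MvPolynomial (Fin n × Fin n) ℂ} (hp : p ∈ permIdeal n 2) : phi s p = 0 := by
  suffices h : ∀ q, phi s (q * p) = 0 by simpa using h 1
  refine Submodule.span_induction (p := fun p _ => ∀ q, phi s (q * p) = 0) ?_ ?_ ?_ ?_ hp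
  · rintro _ ⟨R, C, hR, hC, rfl⟩ q
    obtain ⟨i, k, j, l, hik, hjl, -, -, e⟩ := subPerm_two hR hC
    rw [e]
    induction q using MvPolynomial.induction_on' with
    | add p q hp hq => rw [add_mul, map_add, hp, hq, add_zero]
    | monomial u a =>
      have e : monomial u a = a • mm u := by simp [mm, smul_monomial]
      rw [e, ← mm_ee, ← mm_ee, ← mm_ee, ← mm_ee, smul_mul_assoc, map_smul, mul_add, ← mm_add,
        ← mm_add, ← mm_add, ← mm_add, map_add, phi_mm, phi_mm, hs.1 u i k j l hik hjl, smul_zero]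
  · simp
  · intro x y _ _ hx hy q
    rw [mul_add, map_add, hx, hy, add_zero]
  · intro a x _ hx q
    rw [smul_eq_mul, ← mul_assoc, hx]

set_option maxHeartbeats 2000000 in
lemma finrank_main (n t : ℕ) (ht : 3 ≤ t) :
    Module.finrank ℂ ↥(Submodule.restrictScalars ℂ (permIdeal n 2) ⊓
          homogeneousSubmodule (Fin n × Fin n) ℂ t) + (BB n t).card = (n ^ 2 + t - 1).choose t := by
  classical
  have hex : ∀ b : BB n t, ∃ s, IsSign s b.1.1 b.1.2 := fun b => good_sign b.2
  choose s hs using hex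
  have hm : ∀ b : BB n t, ∃ m, s b m ≠ 0 := fun b => (hs b).2.2
  choose m0 hm0 using hm
  have hmar : ∀ b m, s b m ≠ 0 → (rowM m, colM m) = b.1 := by
    intro b m h
    have := (hs b).2.1 m h
    rw [this.1, this.2]
  have hoff : ∀ b b', b ≠ b' → s b (m0 b') = 0 := by
    intro b b' hne
    by_contra h
    exact hne (Subtype.ext ((hmar _ _ h).symm.trans (hmar _ _ (hm0 b'))))
  have hdeg : ∀ b, (m0 b).degree = t := by
    intro b
    have h1 := (hs b).2.1 _ (hm0 b)
    rw [← rowM_deg, h1.1]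
    exact (mem_BB.1 b.2).1
  let V := homogeneousSubmodule (Fin n × Fin n) ℂ t
  have hmon : ∀ m : Mon n, m.degree = t → mm m ∈ V := fun m hm => isHomogeneous_monomial _ hm
  let Φ : MvPolynomial (Fin n × Fin n) ℂ →ₗ[ℂ] (BB n t → ℂ) := LinearMap.pi fun b => phi (s b)
  let L : V →ₗ[ℂ] (BB n t → ℂ) := Φ ∘ₗ V.subtype
  have hsurj : LinearMap.range L = ⊤ := by
    rw [LinearMap.range_eq_top]
    intro v
    refine ⟨⟨∑ b, (v b / s b (m0 b)) • mm (m0 b),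
      Submodule.sum_mem _ fun b _ => Submodule.smul_mem _ _ (hmon _ (hdeg b))⟩, ?_⟩
    ext b
    show phi (s b) (∑ b, (v b / s b (m0 b)) • mm (m0 b)) = v b
    rw [map_sum, Finset.sum_eq_single b]
    · rw [map_smul, phi_mm, smul_eq_mul, div_mul_cancel₀ _ (hm0 b)]
    · intro b' _ hne
      rw [map_smul, phi_mm, hoff b b' hne.symm, smul_zero]
    · simp
  have hred : ∀ m : Mon n, m.degree = t →
      mm m - ∑ b, (s b m / s b (m0 b)) • mm (m0 b) ∈ permIdeal n 2 := by
    intro m hd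
    by_cases hb : (rowM m, colM m) ∈ BB n t
    · set b0 : BB n t := ⟨_, hb⟩ with hb0
      rw [Finset.sum_eq_single b0]
      · have h1 := (hs b0).2.1 _ (hm0 b0)
        have hE : Eqv m (m0 b0) := eqv_of_margins _ m (m0 b0) rfl h1.1.symm h1.2.symm
        rcases hE with hE | hE
        · have := phi_ideal (hs b0) hE
          rw [map_sub, phi_mm, phi_mm, sub_eq_zero] at this
          rw [this, div_self (hm0 b0), one_smul]
          exact hE
        · have := phi_ideal (hs b0) hE
          rw [map_add, phi_mm, phi_mm] at this
          rw [eq_neg_of_add_eq_zero_left this, neg_div, div_self (hm0 b0), neg_smul, one_smul,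
            sub_neg_eq_add]
          exact hE
      · intro b _ hne
        have : s b m = 0 := by
          by_contra h
          exact hne (Subtype.ext (hmar _ _ h).symm)
        rw [this, zero_div, zero_smul]
      · simp
    · rw [Finset.sum_eq_zero, sub_zero]
      · exact bad_mem ht hd hb
      · intro b _
        have : s b m = 0 := by
          by_contra h
          exact hb (by rw [hmar _ _ h]; exact b.2)
        rw [this, zero_div, zero_smul]
  have hred' : ∀ f ∈ V, f - ∑ b, (phi (s b) f / s b (m0 b)) • mm (m0 b) ∈ permIdeal n 2 := by
    intro f hf
    have hf' := hf
    rw [show V = _ from hom_span n t] at hf'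
    induction hf' using Submodule.span_induction with
    | mem x hx =>
      obtain ⟨⟨m, hm⟩, rfl⟩ := hx
      simp only [phi_mm]
      exact hred m (by simpa [Finsupp.degree_eq_sum] using hm)
    | zero => simp
    | add x y hx hy h1 h2 =>
      convert add_mem (h1 (by show _ ∈ homogeneousSubmodule _ _ _; rw [hom_span]; exact hx))
        (h2 (by show _ ∈ homogeneousSubmodule _ _ _; rw [hom_span]; exact hy)) using 1
      simp only [map_add, add_div, add_smul, Finset.sum_add_distrib]
      ring
    | smul a x hx h1 =>
      have h3 := Ideal.mul_mem_left _ (C a)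
        (h1 (by show _ ∈ homogeneousSubmodule _ _ _; rw [hom_span]; exact hx))
      rw [← smul_eq_C_mul] at h3
      convert h3 using 1
      rw [smul_sub, Finset.smul_sum]
      congr 1
      refine Finset.sum_congr rfl fun b _ => ?_
      rw [map_smul, smul_smul, smul_eq_mul, mul_div_assoc]
  have hker : LinearMap.ker L = (Submodule.restrictScalars ℂ (permIdeal n 2)).comap V.subtype := by
    ext ⟨f, hf⟩
    rw [LinearMap.mem_ker, Submodule.mem_comap]
    constructor
    · intro h
      have h' : ∀ b, phi (s b) f = 0 := fun b => congrFun h b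
      have := hred' f hf
      simpa [h'] using this
    · intro h
      ext b
      exact phi_ideal (hs b) h
  haveI : Module.Finite ℂ V := Module.Finite.iff_fg.2 (homogeneousSubmodule_fg _ _ t)
  have hrk := LinearMap.finrank_range_add_finrank_ker L
  rw [hsurj, finrank_top, Module.finrank_fintype_fun_eq_card, Fintype.card_coe, hker,
    ← Submodule.finrank_map_subtype_eq, Submodule.map_comap_subtype, finrank_hom] at hrk
  rw [inf_comm, add_comm]
  exact hrk

/-- For `n ≥ 3` and `3 ≤ t ≤ n`, the dimension of the degree-`t` component of the ideal
generated by the `2 × 2` sub-permanents of the generic `n × n` matrix. -/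
theorem dim_permIdeal_two_component_low (n : ℕ) (hn : 3 ≤ n) (t : ℕ) (ht3 : 3 ≤ t) (htn : t ≤ n) :
    (Module.finrank ℂ
        ↥(Submodule.restrictScalars ℂ (permIdeal n 2) ⊓
          homogeneousSubmodule (Fin n × Fin n) ℂ t) : ℤ) =
      ((n ^ 2 + t - 1).choose t : ℤ) -
        ((n.choose t : ℤ) ^ 2 + (n : ℤ) ^ 2 +
          ((t : ℤ) - 1) * (((n ^ 2).choose 2 : ℤ) - (n.choose 2 : ℤ) ^ 2) +
          2 * ((t - 1).choose 2 : ℤ) * ((n.choose 2 : ℤ) ^ 2 + (n : ℤ) * (n.choose 3 : ℤ)) +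
          2 * (n : ℤ) * ∑ j ∈ Finset.Icc 3 (t - 1), ((t - 1).choose j : ℤ) * (n.choose (j + 1) : ℤ)) := by
  have h1 := finrank_main n t ht3
  have h2 := card_BB n t ht3
  obtain ⟨s, rfl⟩ : ∃ s, t = s + 1 := ⟨t - 1, by omega⟩
  have h3 := vandermonde n s (by omega)
  simp only [Nat.add_sub_cancel] at h2 ⊢
  rw [show n + (s + 1) - 1 = n + s by omega, h3] at h2
  have hc : ((n ^ 2).choose 2 : ℤ) = 2 * n * n.choose 2 + 2 * (n.choose 2 : ℤ) ^ 2 := by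
    have : ((n ^ 2).choose 2 : ℚ) = 2 * n * n.choose 2 + 2 * (n.choose 2 : ℚ) ^ 2 := by
      rw [Nat.cast_choose_two, Nat.cast_choose_two]
      push_cast
      ring
    exact_mod_cast this
  have hs : (s : ℤ) ^ 2 = s + 2 * s.choose 2 := by
    have : (s : ℚ) ^ 2 = s + 2 * s.choose 2 := by
      rw [Nat.cast_choose_two]
      ring
    exact_mod_cast this
  rw [← h1, hc]
  have h2' := congrArg (Nat.cast : ℕ → ℤ) h2
  push_cast at h2' ⊢
  rw [mul_pow, hs] at h2'
  linear_combination (-1 : ℤ) * h2'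
end

section
/- Let n ≥ 3 and let I = I^{perm_n,2} be the ideal of S generated by all 2×2 sub-permanents of the generic n×n matrix. Then for every integer t > n, the dimension of the degree-t component I_t = I ∩ S_t equals C(n²+t−1, t) − [ n² + (t−1)·(C(n²,2) − C(n,2)²) + 2·C(t−1,2)·(C(n,2)² + n·C(n,3)) + 2n·Σ_{j=3}^{t−1} C(t−1,j)·C(n,j+1) ]. -/
open MvPolynomial

namespace PermTwo


noncomputable def mon {n : ℕ} (s : Multiset (Fin n × Fin n)) : MvPolynomial (Fin n × Fin n) ℂ :=
  (s.map X).prod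

lemma mon_cons {n : ℕ} (a : Fin n × Fin n) (s : Multiset (Fin n × Fin n)) :
    mon (a ::ₘ s) = X a * mon s := by simp [mon]

lemma mon_add {n : ℕ} (s s' : Multiset (Fin n × Fin n)) :
    mon (s + s') = mon s * mon s' := by simp [mon]

lemma monomial_eq_mon {n : ℕ} (f : Fin n × Fin n →₀ ℕ) :
    monomial f (1 : ℂ) = mon (Finsupp.toMultiset f) := by
  rw [mon, Finsupp.toMultiset_map, Finsupp.prod_toMultiset, MvPolynomial.monomial_eq]
  rw [Finsupp.prod_mapDomain_index] <;> simp [pow_add]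

lemma mon_eq_monomial {n : ℕ} (s : Multiset (Fin n × Fin n)) :
    mon s = monomial (Multiset.toFinsupp s) (1 : ℂ) := by
  rw [monomial_eq_mon, Multiset.toFinsupp_toMultiset]

lemma subPerm_two {n : ℕ} {R C : Finset (Fin n)} (hR : R.card = 2) (hC : C.card = 2) :
    ∃ a c b d : Fin n, a ∈ R ∧ c ∈ R ∧ a ≠ c ∧ b ∈ C ∧ d ∈ C ∧ b ≠ d ∧
      subPerm hR hC = X (a, b) * X (c, d) + X (a, d) * X (c, b) := by
  refine ⟨R.orderIsoOfFin hR 0, R.orderIsoOfFin hR 1, C.orderIsoOfFin hC 0,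
    C.orderIsoOfFin hC 1, Subtype.prop _, Subtype.prop _, ?_, Subtype.prop _, Subtype.prop _,
    ?_, ?_⟩
  · intro h
    have := (R.orderIsoOfFin hR).injective (Subtype.ext h)
    simp at this
  · intro h
    have := (C.orderIsoOfFin hC).injective (Subtype.ext h)
    simp at this
  · have hu : (Finset.univ : Finset (Equiv.Perm (Fin 2))) = {1, Equiv.swap 0 1} := by decide
    rw [subPerm, hu, Finset.sum_pair (by decide)]
    simp [Fin.prod_univ_two]

lemma binom_mem {n : ℕ} {a c b d : Fin n} (hac : a ≠ c) (hbd : b ≠ d) :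
    (X (a, b) * X (c, d) + X (a, d) * X (c, b) : MvPolynomial (Fin n × Fin n) ℂ) ∈
      permIdeal n 2 := by
  have hR : ({a, c} : Finset (Fin n)).card = 2 := Finset.card_pair hac
  have hC : ({b, d} : Finset (Fin n)).card = 2 := Finset.card_pair hbd
  have hm : subPerm hR hC ∈ permIdeal n 2 := Ideal.subset_span ⟨_, _, hR, hC, rfl⟩
  obtain ⟨a', c', b', d', h1, h2, h3, h4, h5, h6, h7⟩ := subPerm_two hR hC
  rw [h7] at hm
  simp only [Finset.mem_insert, Finset.mem_singleton] at h1 h2 h4 h5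
  rcases h1 with rfl | rfl <;> rcases h2 with rfl | rfl <;> rcases h4 with rfl | rfl <;>
    rcases h5 with rfl | rfl <;> first | exact absurd rfl h3 | exact absurd rfl h6 | skip
  all_goals
    first
    | exact hm
    | (convert hm using 1; ring)

lemma pat_row {n : ℕ} {a c b b' b'' : Fin n} (hac : a ≠ c) (h1 : b ≠ b') (h2 : b ≠ b'')
    (h3 : b' ≠ b'') :
    (X (a, b) * X (a, b') * X (c, b'') : MvPolynomial (Fin n × Fin n) ℂ) ∈ permIdeal n 2 := by
  have u1 := Ideal.mul_mem_left _ (X (a, b)) (binom_mem hac h3)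
  have u2 := Ideal.mul_mem_left _ (X (a, b'')) (binom_mem hac h1)
  have u3 := Ideal.mul_mem_left _ (X (a, b')) (binom_mem hac h2.symm)
  have := Ideal.mul_mem_left _ (C (1/2 : ℂ)) (Ideal.add_mem _ (Ideal.sub_mem _ u1 u2) u3)
  convert this using 1
  have h : (C (1/2 : ℂ) : MvPolynomial (Fin n × Fin n) ℂ) * 2 = 1 := by
    rw [show (2 : MvPolynomial (Fin n × Fin n) ℂ) = C 2 from (map_ofNat C 2).symm, ← C_mul]; norm_num
  linear_combination (-(X (a, b) * X (a, b') * X (c, b''))) * h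

lemma pat_col {n : ℕ} {a c b b' b'' : Fin n} (hac : a ≠ c) (h1 : b ≠ b') (h2 : b ≠ b'')
    (h3 : b' ≠ b'') :
    (X (b, a) * X (b', a) * X (b'', c) : MvPolynomial (Fin n × Fin n) ℂ) ∈ permIdeal n 2 := by
  have u1 := Ideal.mul_mem_left _ (X (b, a)) (binom_mem h3 hac)
  have u2 := Ideal.mul_mem_left _ (X (b'', a)) (binom_mem h1 hac)
  have u3 := Ideal.mul_mem_left _ (X (b', a)) (binom_mem h2.symm hac)
  have := Ideal.mul_mem_left _ (C (1/2 : ℂ)) (Ideal.add_mem _ (Ideal.sub_mem _ u1 u2) u3)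
  convert this using 1
  have h : (C (1/2 : ℂ) : MvPolynomial (Fin n × Fin n) ℂ) * 2 = 1 := by
    rw [show (2 : MvPolynomial (Fin n × Fin n) ℂ) = C 2 from (map_ofNat C 2).symm, ← C_mul]; norm_num
  linear_combination (-(X (b, a) * X (b', a) * X (b'', c))) * h

/-- Monomials with the same margins agree up to sign modulo the ideal. -/
lemma connect {n : ℕ} : ∀ (s s' : Multiset (Fin n × Fin n)), s.map Prod.fst = s'.map Prod.fst →
    s.map Prod.snd = s'.map Prod.snd →
    ∃ ε : ℂ, ε * ε = 1 ∧ mon s - C ε * mon s' ∈ permIdeal n 2 := by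
  intro s
  induction s using Multiset.induction_on with
  | empty =>
    intro s' h1 _
    have : s' = 0 := by simpa using h1.symm
    subst this
    exact ⟨1, by simp⟩
  | cons p s ih =>
    obtain ⟨a, b⟩ := p
    intro s' h1 h2
    by_cases hp : (a, b) ∈ s'
    · obtain ⟨w, rfl⟩ := Multiset.exists_cons_of_mem hp
      simp only [Multiset.map_cons, Multiset.cons_inj_right] at h1 h2
      obtain ⟨ε, he, hm⟩ := ih w h1 h2
      refine ⟨ε, he, ?_⟩
      have := Ideal.mul_mem_left _ (X (a, b)) hm
      convert this using 1
      rw [mon_cons, mon_cons]; ring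
    · have ha : a ∈ s'.map Prod.fst := by rw [← h1]; simp
      have hb : b ∈ s'.map Prod.snd := by rw [← h2]; simp
      obtain ⟨⟨a1, b'⟩, hm1, rfl⟩ := Multiset.mem_map.1 ha
      obtain ⟨⟨c, b1⟩, hm2, rfl⟩ := Multiset.mem_map.1 hb
      simp only at *
      have hbb : b1 ≠ b' := by rintro rfl; exact hp hm1
      have hac : a1 ≠ c := by rintro rfl; exact hp hm2
      obtain ⟨w, rfl⟩ := Multiset.exists_cons_of_mem hm1
      have hm2' : (c, b1) ∈ w := by
        rcases Multiset.mem_cons.1 hm2 with h | h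
        · exact absurd (Prod.ext_iff.1 h).1.symm hac
        · exact h
      obtain ⟨v, rfl⟩ := Multiset.exists_cons_of_mem hm2'
      simp only [Multiset.map_cons, Multiset.cons_inj_right] at h1 h2
      rw [Multiset.cons_swap, Multiset.cons_inj_right] at h2
      obtain ⟨ε, he, hm⟩ := ih ((c, b') ::ₘ v) (by simpa using h1) (by simpa using h2)
      refine ⟨-ε, by simpa using he, ?_⟩
      have u1 := Ideal.mul_mem_left _ (X (a1, b1)) hm
      have u2 := Ideal.mul_mem_left _ (C ε * mon v) (binom_mem hac hbb)
      convert Ideal.add_mem _ u1 u2 using 1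
      simp only [mon_cons, C_neg]; ring

/-- Any pair of margins is realised. -/
lemma exists_marg {n : ℕ} : ∀ (R D : Multiset (Fin n)), R.card = D.card →
    ∃ s : Multiset (Fin n × Fin n), s.map Prod.fst = R ∧ s.map Prod.snd = D := by
  intro R
  induction R using Multiset.induction_on with
  | empty => intro D h; exact ⟨0, by simp, by simpa [eq_comm] using h⟩
  | cons a R ih =>
    intro D h
    have : ∃ b, b ∈ D := by
      apply Multiset.card_pos_iff_exists_mem.1; rw [← h]; simp
    obtain ⟨b, hb⟩ := this
    obtain ⟨D', rfl⟩ := Multiset.exists_cons_of_mem hb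
    obtain ⟨s, h1, h2⟩ := ih D' (by simpa using h)
    exact ⟨(a, b) ::ₘ s, by simp [h1], by simp [h2]⟩

lemma exists_three {n : ℕ} (D : Multiset (Fin n)) (h : 3 ≤ D.toFinset.card) :
    ∃ b b' b'' D', b ≠ b' ∧ b ≠ b'' ∧ b' ≠ b'' ∧ D = b ::ₘ b' ::ₘ b'' ::ₘ D' := by
  obtain ⟨b, b', b'', h1, h2, h3, h4, h5, h6⟩ := Finset.two_lt_card_iff.1 h
  simp only [Multiset.mem_toFinset] at h1 h2 h3
  have hle : ({b, b', b''} : Multiset (Fin n)) ≤ D := by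
    rw [Multiset.le_iff_subset (by simp [h4, h5, h6])]
    intro x hx
    simp at hx
    rcases hx with rfl | rfl | rfl <;> assumption
  obtain ⟨D', rfl⟩ := Multiset.le_iff_exists_add.1 hle
  exact ⟨b, b', b'', D', h4, h5, h6, by simp⟩

lemma exists_two {n : ℕ} (R : Multiset (Fin n)) (h : 2 ≤ R.toFinset.card) (hn : n < R.card) :
    ∃ a c R', a ≠ c ∧ R = a ::ₘ a ::ₘ c ::ₘ R' := by
  have hnd : ¬ R.Nodup := by
    intro h
    have := Multiset.toFinset_card_of_nodup h
    have h2 := Finset.card_le_univ R.toFinset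
    simp at h2; omega
  rw [Multiset.nodup_iff_le] at hnd
  push Not at hnd
  obtain ⟨a, ha⟩ := hnd
  obtain ⟨R1, rfl⟩ := Multiset.le_iff_exists_add.1 ha
  have : ∃ c ∈ R1, c ≠ a := by
    by_contra! hc
    have : (a ::ₘ a ::ₘ 0 + R1).toFinset ⊆ {a} := by
      intro x hx
      simp at hx
      rcases hx with rfl | hx
      · simp
      · simp [hc x hx]
    have := Finset.card_le_card this
    rw [Finset.card_singleton] at this
    omega
  obtain ⟨c, hc, hca⟩ := this
  obtain ⟨R', rfl⟩ := Multiset.exists_cons_of_mem hc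
  refine ⟨a, c, R', hca.symm, ?_⟩
  rw [Multiset.cons_add, Multiset.cons_add, zero_add]

def Good {n : ℕ} (R D : Multiset (Fin n)) : Prop :=
  R.toFinset.card ≤ 1 ∨ D.toFinset.card ≤ 1 ∨ (R.toFinset.card ≤ 2 ∧ D.toFinset.card ≤ 2)

lemma mem_of_connect {n : ℕ} {s s' : Multiset (Fin n × Fin n)}
    (h1 : s.map Prod.fst = s'.map Prod.fst) (h2 : s.map Prod.snd = s'.map Prod.snd)
    (h : mon s' ∈ permIdeal n 2) : mon s ∈ permIdeal n 2 := by
  obtain ⟨ε, -, hm⟩ := connect s s' h1 h2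
  have := Ideal.add_mem _ hm (Ideal.mul_mem_left _ (C ε) h)
  simpa using this

lemma bad_mem {n : ℕ} (s : Multiset (Fin n × Fin n)) (hn : n < s.card)
    (hb : ¬ Good (s.map Prod.fst) (s.map Prod.snd)) : mon s ∈ permIdeal n 2 := by
  unfold Good at hb
  push Not at hb
  obtain ⟨h1, h2, h3⟩ := hb
  by_cases hD : 3 ≤ (s.map Prod.snd).toFinset.card
  · obtain ⟨b, b', b'', D', e1, e2, e3, hD⟩ := exists_three _ hD
    obtain ⟨a, c, R', hac, hR⟩ := exists_two (s.map Prod.fst) h1 (by simpa using hn)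
    have hc : R'.card = D'.card := by
      have e := congrArg Multiset.card hD
      have e' := congrArg Multiset.card hR
      simp at e e'; omega
    obtain ⟨w, hw1, hw2⟩ := exists_marg R' D' hc
    apply mem_of_connect (s' := (a, b) ::ₘ (a, b') ::ₘ (c, b'') ::ₘ w) (by simp [hw1, hR])
      (by simp [hw2, hD])
    have := Ideal.mul_mem_left _ (mon w) (pat_row hac e1 e2 e3)
    convert this using 1
    simp only [mon_cons]; ring
  · have hR : 3 ≤ (s.map Prod.fst).toFinset.card := by
      by_contra h
      have := h3 (by omega); omega
    obtain ⟨b, b', b'', D', e1, e2, e3, hD⟩ := exists_three _ hR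
    obtain ⟨a, c, R', hac, hR⟩ := exists_two (s.map Prod.snd) h2 (by simpa using hn)
    have hc : D'.card = R'.card := by
      have e := congrArg Multiset.card hD
      have e' := congrArg Multiset.card hR
      simp at e e'; omega
    obtain ⟨w, hw1, hw2⟩ := exists_marg D' R' hc
    apply mem_of_connect (s' := (b, a) ::ₘ (b', a) ::ₘ (b'', c) ::ₘ w) (by simp [hw1, hD])
      (by simp [hw2, hR])
    have := Ideal.mul_mem_left _ (mon w) (pat_col hac e1 e2 e3)
    convert this using 1
    simp only [mon_cons]; ring

noncomputable def sg {n : ℕ} (e : Multiset (Fin n) → Fin n) (s : Multiset (Fin n × Fin n)) : ℂ :=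
  (-1) ^ (s.count (e (s.map Prod.fst), e (s.map Prod.snd)))

lemma sg_mul_self {n : ℕ} (e : Multiset (Fin n) → Fin n) (s : Multiset (Fin n × Fin n)) :
    sg e s * sg e s = 1 := by
  rw [sg, ← pow_add, ← two_mul, pow_mul]; simp

def G (n t : ℕ) : Type := {g : Sym (Fin n) t × Sym (Fin n) t // Good g.1.1 g.2.1}

noncomputable instance (n t : ℕ) : Fintype (G n t) := by
  classical
  unfold G
  infer_instance

noncomputable instance (n t : ℕ) : DecidableEq (G n t) := Classical.decEq _

open Classical in
noncomputable def Phi {n : ℕ} (e : Multiset (Fin n) → Fin n) (t : ℕ) :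
    MvPolynomial (Fin n × Fin n) ℂ →ₗ[ℂ] (G n t → ℂ) :=
  (basisMonomials (Fin n × Fin n) ℂ).constr ℂ fun f g =>
    if (Finsupp.toMultiset f).map Prod.fst = g.1.1.1 ∧ (Finsupp.toMultiset f).map Prod.snd = g.1.2.1
    then sg e (Finsupp.toMultiset f) else 0

open Classical in
lemma Phi_mon {n : ℕ} (e : Multiset (Fin n) → Fin n) (t : ℕ) (s : Multiset (Fin n × Fin n))
    (g : G n t) :
    Phi e t (mon s) g =
      if s.map Prod.fst = g.1.1.1 ∧ s.map Prod.snd = g.1.2.1 then sg e s else 0 := by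
  have : mon s = basisMonomials (Fin n × Fin n) ℂ (Multiset.toFinsupp s) := by
    rw [mon_eq_monomial, coe_basisMonomials]
  rw [this, Phi, Module.Basis.constr_basis]
  simp only [Multiset.toFinsupp_toMultiset]

lemma pair_of_card {n : ℕ} (R : Multiset (Fin n)) (h : R.toFinset.card ≤ 2) {a c i : Fin n}
    (hac : a ≠ c) (ha : a ∈ R) (hc : c ∈ R) (hi : i ∈ R) : i = a ∨ i = c := by
  by_contra! hh
  have : ({a, c, i} : Finset (Fin n)) ⊆ R.toFinset := by
    intro x hx
    simp at hx
    rcases hx with rfl | rfl | rfl <;> simpa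
  have h2 := Finset.card_le_card this
  rw [Finset.card_eq_three.2 ⟨a, c, i, hac, hh.1.symm, hh.2.symm, rfl⟩] at h2
  omega

lemma one_of_card {n : ℕ} (R : Multiset (Fin n)) (h : R.toFinset.card ≤ 1) {a c : Fin n}
    (ha : a ∈ R) (hc : c ∈ R) : a = c :=
  Finset.card_le_one.1 h a (by simpa) c (by simpa)

lemma sg_swap {n : ℕ} (e : Multiset (Fin n) → Fin n) (he : ∀ R, R ≠ 0 → e R ∈ R)
    {a c b d : Fin n} (hac : a ≠ c) (hbd : b ≠ d) (s : Multiset (Fin n × Fin n))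
    (hg : Good (((a, b) ::ₘ (c, d) ::ₘ s).map Prod.fst) (((a, b) ::ₘ (c, d) ::ₘ s).map Prod.snd)) :
    sg e ((a, b) ::ₘ (c, d) ::ₘ s) + sg e ((a, d) ::ₘ (c, b) ::ₘ s) = 0 := by
  have hsw : ((a, d) ::ₘ (c, b) ::ₘ s).map Prod.snd = ((a, b) ::ₘ (c, d) ::ₘ s).map Prod.snd := by
    simp [Multiset.cons_swap]
  have hsw' : ((a, d) ::ₘ (c, b) ::ₘ s).map Prod.fst = ((a, b) ::ₘ (c, d) ::ₘ s).map Prod.fst := by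
    simp
  unfold sg
  rw [hsw, hsw']
  set R := ((a, b) ::ₘ (c, d) ::ₘ s).map Prod.fst with hR
  set D := ((a, b) ::ₘ (c, d) ::ₘ s).map Prod.snd with hD
  have ha : a ∈ R := by simp [hR]
  have hc : c ∈ R := by simp [hR]
  have hb : b ∈ D := by simp [hD]
  have hd : d ∈ D := by simp [hD]
  have hR0 : e R ∈ R := he R (by rintro h; simp [h] at ha)
  have hD0 : e D ∈ D := he D (by rintro h; simp [h] at hb)
  rcases hg with h | h | ⟨h1, h2⟩
  · exact absurd (one_of_card R h ha hc) hac
  · exact absurd (one_of_card D h hb hd) hbd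
  rcases pair_of_card R h1 hac ha hc hR0 with h | h <;>
    rcases pair_of_card D h2 hbd hb hd hD0 with h' | h' <;> rw [h, h'] <;>
    simp [hac, hbd, hac.symm, hbd.symm, pow_add]

lemma Phi_ideal {n : ℕ} (e : Multiset (Fin n) → Fin n) (he : ∀ R, R ≠ 0 → e R ∈ R) (t : ℕ)
    {p : MvPolynomial (Fin n × Fin n) ℂ} (hp : p ∈ permIdeal n 2) : Phi e t p = 0 := by
  suffices h : ∀ q, Phi e t (q * p) = 0 by simpa using h 1
  unfold permIdeal at hp
  induction hp using Submodule.span_induction with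
  | zero => simp
  | add x y _ _ hx hy => intro q; rw [mul_add, map_add, hx, hy, add_zero]
  | smul r x _ hx => intro q; rw [smul_eq_mul, ← mul_assoc]; exact hx _
  | mem x hx =>
    obtain ⟨R, D, hR, hD, rfl⟩ := hx
    obtain ⟨a, c, b, d, -, -, hac, -, -, hbd, h⟩ := subPerm_two hR hD
    intro q
    rw [h]
    induction q using MvPolynomial.induction_on' with
    | monomial f r =>
      rw [show monomial f r = r • monomial f (1 : ℂ) by simp [smul_monomial], smul_mul_assoc,
        map_smul, monomial_eq_mon]
      have : mon (Finsupp.toMultiset f) * (X (a, b) * X (c, d) + X (a, d) * X (c, b)) =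
          mon ((a, b) ::ₘ (c, d) ::ₘ (Finsupp.toMultiset f)) +
          mon ((a, d) ::ₘ (c, b) ::ₘ (Finsupp.toMultiset f)) := by
        simp only [mon_cons]; ring
      rw [this, map_add]
      generalize Finsupp.toMultiset f = s
      convert smul_zero r
      funext g
      rw [Pi.add_apply, Phi_mon, Phi_mon]
      have hsw : ((a, d) ::ₘ (c, b) ::ₘ s).map Prod.snd =
          ((a, b) ::ₘ (c, d) ::ₘ s).map Prod.snd := by
        simp [Multiset.cons_swap]
      have hsw' : ((a, d) ::ₘ (c, b) ::ₘ s).map Prod.fst =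
          ((a, b) ::ₘ (c, d) ::ₘ s).map Prod.fst := by
        simp
      rw [hsw, hsw']
      split_ifs with hh
      · refine sg_swap e he hac hbd s ?_
        rw [hh.1, hh.2]; exact g.2
      · simp
    | add x y hx hy => rw [add_mul, map_add, hx, hy, add_zero]

lemma exists_rep {n t : ℕ} (g : G n t) : ∃ s : Multiset (Fin n × Fin n),
    s.map Prod.fst = g.1.1.1 ∧ s.map Prod.snd = g.1.2.1 :=
  exists_marg _ _ (g.1.1.2.trans g.1.2.2.symm)

noncomputable def rep {n t : ℕ} (g : G n t) : Multiset (Fin n × Fin n) := (exists_rep g).choose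

lemma rep_fst {n t : ℕ} (g : G n t) : (rep g).map Prod.fst = g.1.1.1 := (exists_rep g).choose_spec.1
lemma rep_snd {n t : ℕ} (g : G n t) : (rep g).map Prod.snd = g.1.2.1 := (exists_rep g).choose_spec.2

lemma G_ext {n t : ℕ} {g h : G n t} (h1 : g.1.1.1 = h.1.1.1) (h2 : g.1.2.1 = h.1.2.1) : g = h :=
  Subtype.ext (Prod.ext (Subtype.ext h1) (Subtype.ext h2))

lemma Phi_rep {n t : ℕ} (e : Multiset (Fin n) → Fin n) (g : G n t) :
    Phi e t (mon (rep g)) = Pi.single g (sg e (rep g)) := by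
  classical
  funext h
  rw [Phi_mon, rep_fst, rep_snd]
  by_cases hgh : h = g
  · subst hgh; simp
  · rw [Pi.single_eq_of_ne hgh, if_neg]
    rintro ⟨h1, h2⟩
    exact hgh (G_ext h1.symm h2.symm)

noncomputable def Psi {n : ℕ} (e : Multiset (Fin n) → Fin n) (t : ℕ) :
    (G n t → ℂ) →ₗ[ℂ] MvPolynomial (Fin n × Fin n) ℂ :=
  (Pi.basisFun ℂ (G n t)).constr ℂ fun g => sg e (rep g) • mon (rep g)

lemma Psi_single {n : ℕ} (e : Multiset (Fin n) → Fin n) (t : ℕ) (g : G n t) (r : ℂ) :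
    Psi e t (Pi.single g r) = (r * sg e (rep g)) • mon (rep g) := by
  have : (Pi.single g r : G n t → ℂ) = r • Pi.basisFun ℂ (G n t) g := by
    rw [Pi.basisFun_apply, ← Pi.single_smul]; simp
  rw [this, map_smul, Psi, Module.Basis.constr_basis, smul_smul]

lemma Phi_Psi {n : ℕ} (e : Multiset (Fin n) → Fin n) (t : ℕ) (h : G n t → ℂ) :
    Phi e t (Psi e t h) = h := by
  have : (Phi e t).comp (Psi e t) = LinearMap.id := by
    apply (Pi.basisFun ℂ (G n t)).ext
    intro g
    rw [LinearMap.comp_apply, Pi.basisFun_apply, Psi_single, map_smul, Phi_rep, ← Pi.single_smul]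
    simp [sg_mul_self]
  exact LinearMap.congr_fun this h

lemma mon_homog {n t : ℕ} (s : Multiset (Fin n × Fin n)) (hs : s.card = t) :
    mon s ∈ homogeneousSubmodule (Fin n × Fin n) ℂ t := by
  rw [mon_eq_monomial]
  apply isHomogeneous_monomial
  rw [← hs, ← Multiset.toFinsupp_sum_eq]
  rfl

lemma Psi_homog {n : ℕ} (e : Multiset (Fin n) → Fin n) (t : ℕ) (h : G n t → ℂ) :
    Psi e t h ∈ homogeneousSubmodule (Fin n × Fin n) ℂ t := by
  rw [← Finset.univ_sum_single h, map_sum]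
  apply Submodule.sum_mem
  intro g _
  rw [Psi_single]
  apply Submodule.smul_mem
  apply mon_homog
  have := congrArg Multiset.card (rep_fst g)
  rw [Multiset.card_map] at this
  rw [this]; exact g.1.1.2

lemma sub_mem_mon {n : ℕ} (e : Multiset (Fin n) → Fin n) (he : ∀ R, R ≠ 0 → e R ∈ R) (t : ℕ)
    (ht : n < t) (s : Multiset (Fin n × Fin n)) (hs : s.card = t) :
    mon s - Psi e t (Phi e t (mon s)) ∈ permIdeal n 2 := by
  classical
  by_cases hg : Good (s.map Prod.fst) (s.map Prod.snd)
  · let g : G n t := ⟨(⟨s.map Prod.fst, by simpa using hs⟩, ⟨s.map Prod.snd, by simpa using hs⟩), hg⟩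
    obtain ⟨ε, h1, h2⟩ := connect s (rep g) (rep_fst g).symm (rep_snd g).symm
    have h3 := Phi_ideal e he t h2
    rw [map_sub, ← MvPolynomial.smul_eq_C_mul, map_smul, sub_eq_zero] at h3
    rw [h3, map_smul, Phi_rep, Psi_single, sg_mul_self, one_smul, MvPolynomial.smul_eq_C_mul]
    exact h2
  · have : Phi e t (mon s) = 0 := by
      funext g
      rw [Phi_mon, if_neg]
      · rfl
      · rintro ⟨h1, h2⟩
        apply hg; rw [h1, h2]; exact g.2
    rw [this, map_zero, sub_zero]
    exact bad_mem s (by omega) hg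

lemma sub_mem_all {n : ℕ} (e : Multiset (Fin n) → Fin n) (he : ∀ R, R ≠ 0 → e R ∈ R) (t : ℕ)
    (ht : n < t) (p : MvPolynomial (Fin n × Fin n) ℂ)
    (hp : p ∈ homogeneousSubmodule (Fin n × Fin n) ℂ t) :
    p - Psi e t (Phi e t p) ∈ permIdeal n 2 := by
  have key : ∀ f ∈ p.support, monomial f (coeff f p) -
      Psi e t (Phi e t (monomial f (coeff f p))) ∈ permIdeal n 2 := by
    intro f hf
    have hd : f.degree = t := by
      have := hp (mem_support_iff.1 hf)
      rw [Finsupp.degree_eq_weight_one]; exact this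
    rw [show monomial f (coeff f p) = coeff f p • monomial f (1 : ℂ) by simp [smul_monomial],
      map_smul, map_smul, ← smul_sub, MvPolynomial.smul_eq_C_mul]
    apply Ideal.mul_mem_left
    rw [monomial_eq_mon]
    apply sub_mem_mon e he t ht
    rw [Finsupp.card_toMultiset, ← hd]; rfl
  have := Ideal.sum_mem _ key
  rw [Finset.sum_sub_distrib, ← map_sum, ← map_sum, support_sum_monomial_coeff] at this
  exact this

lemma finrank_homog (n t : ℕ) : Module.finrank ℂ (homogeneousSubmodule (Fin n × Fin n) ℂ t) =
    (n ^ 2 + t - 1).choose t := by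
  classical
  rw [homogeneousSubmodule_eq_finsupp_supported]
  rw [(AddMonoidAlgebra.supportedEquivFinsupp _).finrank_eq]
  let E : Sym (Fin n × Fin n) t ≃ {d : Fin n × Fin n →₀ ℕ | d.degree = t} := Sym.equivNatSum _ _
  have := Fintype.ofEquiv _ E
  rw [Module.finrank_finsupp_self, ← Fintype.card_congr E, Sym.card_sym_eq_choose]
  simp [sq]

lemma finrank_main (n t : ℕ) (hn : 0 < n) (ht : n < t) :
    Fintype.card (G n t) + Module.finrank ℂ
        ↥(Submodule.restrictScalars ℂ (permIdeal n 2) ⊓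
          homogeneousSubmodule (Fin n × Fin n) ℂ t) = (n ^ 2 + t - 1).choose t := by
  have : ∃ e : Multiset (Fin n) → Fin n, ∀ R, R ≠ 0 → e R ∈ R := by
    have : ∀ R : Multiset (Fin n), ∃ i, R ≠ 0 → i ∈ R := by
      intro R
      by_cases h : R = 0
      · exact ⟨⟨0, hn⟩, fun h' => absurd h h'⟩
      · obtain ⟨i, hi⟩ := Multiset.exists_mem_of_ne_zero h
        exact ⟨i, fun _ => hi⟩
    choose e he using this
    exact ⟨e, he⟩
  obtain ⟨e, he⟩ := this
  let φ := (Phi e t).domRestrict (homogeneousSubmodule (Fin n × Fin n) ℂ t)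
  have : FiniteDimensional ℂ (homogeneousSubmodule (Fin n × Fin n) ℂ t) :=
    Module.Finite.iff_fg.2 (homogeneousSubmodule_fg _ _ t)
  have h1 := LinearMap.finrank_range_add_finrank_ker φ
  have h2 : LinearMap.range φ = ⊤ := by
    rw [LinearMap.range_eq_top]
    intro h
    exact ⟨⟨Psi e t h, Psi_homog e t h⟩, Phi_Psi e t h⟩
  have h3 : (LinearMap.ker φ).map (homogeneousSubmodule (Fin n × Fin n) ℂ t).subtype =
      Submodule.restrictScalars ℂ (permIdeal n 2) ⊓
          homogeneousSubmodule (Fin n × Fin n) ℂ t := by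
    ext p
    simp only [Submodule.mem_map, LinearMap.mem_ker, Submodule.mem_inf,
      Submodule.restrictScalars_mem]
    constructor
    · rintro ⟨⟨q, hq⟩, hk, rfl⟩
      refine ⟨?_, hq⟩
      have hk' : Phi e t q = 0 := hk
      have := sub_mem_all e he t ht q hq
      rw [hk', map_zero, sub_zero] at this
      exact this
    · rintro ⟨h, h'⟩
      exact ⟨⟨p, h'⟩, Phi_ideal e he t h, rfl⟩
  rw [h2, finrank_top, Module.finrank_fintype_fun_eq_card, finrank_homog] at h1
  rw [← h1, ← h3]
  congr 1
  exact Submodule.finrank_map_subtype_eq _ _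

lemma card_lt_pairs (n : ℕ) :
    (Finset.univ.filter fun p : Fin n × Fin n => p.1 < p.2).card = n.choose 2 := by
  classical
  rw [Finset.card_filter, Fintype.sum_prod_type_right]
  simp only [← Finset.card_filter]
  have : ∀ j : Fin n, (Finset.univ.filter fun i : Fin n => i < j).card = (j : ℕ) := by
    intro j
    rw [Finset.filter_gt_eq_Iio, Fin.card_Iio]
  simp only [this]
  rw [Fin.sum_univ_eq_sum_range (fun i => i) n, Finset.sum_range_id, Nat.choose_two_right]

def cd {n t : ℕ} (m : Sym (Fin n) t) : ℕ := m.1.toFinset.card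

def GoodS {n t : ℕ} (g : Sym (Fin n) t × Sym (Fin n) t) : Prop := Good g.1.1 g.2.1

lemma GoodS_iff {n t : ℕ} (g : Sym (Fin n) t × Sym (Fin n) t) : GoodS g ↔
    (cd g.1 ≤ 1 ∨ cd g.2 ≤ 1 ∨ (cd g.1 ≤ 2 ∧ cd g.2 ≤ 2)) := Iff.rfl

lemma count_one (n t : ℕ) (ht : 0 < t) :
    (Finset.univ.filter fun m : Sym (Fin n) t => cd m ≤ 1).card = n := by
  classical
  conv_rhs => rw [← Fintype.card_fin n, ← Finset.card_univ]
  symm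
  refine Finset.card_bij (fun i _ => Sym.replicate t i) ?_ ?_ ?_
  · intro i _
    refine Finset.mem_filter.2 ⟨Finset.mem_univ _, ?_⟩
    change (Multiset.replicate t i).toFinset.card ≤ 1
    rw [Multiset.toFinset_replicate]
    split_ifs <;> simp
  · intro i _ j _ h
    have h' : Multiset.replicate t i = Multiset.replicate t j := congrArg Subtype.val h
    exact Multiset.replicate_right_injective ht.ne' h'
  · intro m hm
    simp only [Finset.mem_filter, Finset.mem_univ, true_and] at hm
    have : ∃ i, i ∈ m.1 := by
      apply Multiset.card_pos_iff_exists_mem.1; rw [m.2]; exact ht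
    obtain ⟨i, hi⟩ := this
    refine ⟨i, Finset.mem_univ _, ?_⟩
    apply Subtype.ext
    change Multiset.replicate t i = m.1
    symm
    rw [Multiset.eq_replicate]
    exact ⟨m.2, fun b hb => one_of_card _ hm hb hi⟩

lemma count_two (n t : ℕ) :
    (Finset.univ.filter fun m : Sym (Fin n) t => cd m = 2).card =
      n.choose 2 * (t - 1) := by
  classical
  rw [← card_lt_pairs n, show t - 1 = (Finset.Ioo 0 t).card by simp, ← Finset.card_product]
  symm
  have hts : ∀ (i j : Fin n) (k l : ℕ), k ≠ 0 → l ≠ 0 →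
      (Multiset.replicate k i + Multiset.replicate l j).toFinset = {i, j} := by
    intro i j k l hk hl
    rw [Multiset.toFinset_add, Multiset.toFinset_replicate, Multiset.toFinset_replicate,
      if_neg hk, if_neg hl]
    rfl
  refine Finset.card_bij (fun x hx => ⟨Multiset.replicate x.2 x.1.1 +
    Multiset.replicate (t - x.2) x.1.2, ?_⟩) ?_ ?_ ?_
  · simp only [Finset.mem_product, Finset.mem_Ioo] at hx
    simp; omega
  · rintro ⟨⟨i, j⟩, k⟩ hx
    simp only [Finset.mem_product, Finset.mem_filter, Finset.mem_univ, true_and,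
      Finset.mem_Ioo] at hx
    refine Finset.mem_filter.2 ⟨Finset.mem_univ _, ?_⟩
    change (Multiset.replicate k i + Multiset.replicate (t - k) j).toFinset.card = 2
    rw [hts _ _ _ _ (by omega) (by omega), Finset.card_pair hx.1.ne]
  · rintro ⟨⟨i, j⟩, k⟩ hx ⟨⟨i', j'⟩, k'⟩ hx' h
    simp only [Finset.mem_product, Finset.mem_filter, Finset.mem_univ, true_and,
      Finset.mem_Ioo] at hx hx'
    have h := congrArg Subtype.val h
    simp only at h
    have hf := congrArg Multiset.toFinset h
    rw [hts _ _ _ _ (by omega) (by omega), hts _ _ _ _ (by omega) (by omega)] at hf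
    have e1 : i = i' ∨ i = j' := by
      have : i ∈ ({i', j'} : Finset (Fin n)) := by rw [← hf]; simp
      simpa using this
    have e2 : j = i' ∨ j = j' := by
      have : j ∈ ({i', j'} : Finset (Fin n)) := by rw [← hf]; simp
      simpa using this
    have h1 := hx.1
    have h2 := hx'.1
    have : i = i' ∧ j = j' := by
      rcases e1 with e1 | e1 <;> rcases e2 with e2 | e2
      · rw [e1, e2] at h1; exact absurd h1 (lt_irrefl _)
      · exact ⟨e1, e2⟩
      · rw [e1, e2] at h1; exact absurd h1 (lt_asymm h2)
      · rw [e1, e2] at h1; exact absurd h1 (lt_irrefl _)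
    obtain ⟨rfl, rfl⟩ := this
    have hc := congrArg (Multiset.count i) h
    simp [Multiset.count_replicate, h1.ne, h1.ne'] at hc
    rw [hc]
  · intro m hm
    simp only [Finset.mem_filter, Finset.mem_univ, true_and] at hm
    have : ∃ i j, i < j ∧ m.1.toFinset = {i, j} := by
      obtain ⟨x, y, hxy, hh⟩ := Finset.card_eq_two.1 hm
      rcases lt_or_gt_of_ne hxy with h | h
      · exact ⟨x, y, h, hh⟩
      · exact ⟨y, x, h, by rw [hh, Finset.pair_comm]⟩
    obtain ⟨i, j, hij, hh⟩ := this
    have hi : 0 < m.1.count i := by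
      rw [Multiset.count_pos, ← Multiset.mem_toFinset, hh]; simp
    have hj : 0 < m.1.count j := by
      rw [Multiset.count_pos, ← Multiset.mem_toFinset, hh]; simp
    have hs : m.1.count i + m.1.count j = t := by
      have := Multiset.toFinset_sum_count_eq m.1
      rw [hh, Finset.sum_pair hij.ne, m.2] at this
      exact this
    refine ⟨((i, j), m.1.count i), ?_, ?_⟩
    · simp only [Finset.mem_product, Finset.mem_filter, Finset.mem_univ, true_and,
        Finset.mem_Ioo]
      exact ⟨hij, hi, by omega⟩
    · apply Subtype.ext
      change Multiset.replicate (m.1.count i) i + Multiset.replicate (t - m.1.count i) j = m.1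
      ext x
      rw [Multiset.count_add, Multiset.count_replicate, Multiset.count_replicate]
      by_cases hxi : i = x
      · subst hxi; simp [hij.ne']
      · by_cases hxj : j = x
        · subst hxj
          rw [if_neg hxi, if_pos rfl]
          omega
        · simp only [hxi, hxj, if_false]
          symm
          rw [add_zero, Multiset.count_eq_zero, ← Multiset.mem_toFinset, hh]
          simp [Ne.symm hxi, Ne.symm hxj]

lemma card_G (n t : ℕ) (ht : 0 < t) : (Fintype.card (G n t) : ℤ) =
    2 * n * ((n + t - 1).choose t) - (n : ℤ) ^ 2 + ((n.choose 2 : ℤ) * ((t : ℤ) - 1)) ^ 2 := by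
  classical
  have h0 : @Fintype.card (G n t) _ =
      (Finset.univ.filter fun g : Sym (Fin n) t × Sym (Fin n) t => GoodS g).card :=
    by
    refine Fintype.card_of_subtype (p := fun g : Sym (Fin n) t × Sym (Fin n) t => GoodS g) _ ?_
    intro x
    simp only [Finset.mem_filter, Finset.mem_univ, true_and]
  set A := Finset.univ.filter fun m : Sym (Fin n) t => cd m ≤ 1 with hA
  set B := Finset.univ.filter fun m : Sym (Fin n) t => cd m = 2 with hB
  have hs : (Finset.univ.filter fun g : Sym (Fin n) t × Sym (Fin n) t => GoodS g) =
      ((A ×ˢ Finset.univ) ∪ (Aᶜ ×ˢ A)) ∪ B ×ˢ B := by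
    ext ⟨x, y⟩
    simp only [GoodS_iff, Finset.mem_filter, Finset.mem_univ, true_and, Finset.mem_union,
      Finset.mem_product, Finset.mem_compl, hA, hB, and_true]
    omega
  have hT : Fintype.card (Sym (Fin n) t) = (n + t - 1).choose t := by
    rw [Sym.card_sym_eq_choose, Fintype.card_fin]
  have hA1 : A.card = n := count_one n t ht
  have hB1 : B.card = n.choose 2 * (t - 1) := count_two n t
  have hAc : (Aᶜ.card : ℤ) = (n + t - 1).choose t - n := by
    have := Finset.card_add_card_compl A
    rw [hA1, hT] at this
    rw [← this]; push_cast; ring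
  rw [h0, hs, Finset.card_union_of_disjoint, Finset.card_union_of_disjoint, Finset.card_product,
    Finset.card_product, Finset.card_product, Finset.card_univ, hT, hA1, hB1]
  · push_cast [Nat.cast_sub (show 1 ≤ t from ht)]
    rw [hAc]; ring
  · rw [Finset.disjoint_left]
    rintro ⟨x, y⟩ h1 h2
    simp only [Finset.mem_product, Finset.mem_compl] at h1 h2
    exact h2.1 h1.1
  · rw [Finset.disjoint_left]
    rintro ⟨x, y⟩ h1 h2
    simp only [Finset.mem_filter, Finset.mem_univ, true_and, Finset.mem_union,
      Finset.mem_product, Finset.mem_compl, hA, hB, and_true] at h1 h2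
    omega

lemma vander (n t : ℕ) (hn : 3 ≤ n) (ht : n < t) :
    ((n + t - 1).choose t : ℤ) = n + ((t : ℤ) - 1) * n.choose 2 + (t - 1).choose 2 * n.choose 3 +
      ∑ j ∈ Finset.Icc 3 (t - 1), ((t - 1).choose j : ℤ) * (n.choose (j + 1) : ℤ) := by
  obtain ⟨u, rfl⟩ : ∃ u, t = u + 1 := ⟨t - 1, by omega⟩
  have h1 : (n + (u + 1) - 1).choose (u + 1) =
      ∑ j ∈ Finset.range (u + 1), u.choose j * n.choose (j + 1) := by
    rw [show n + (u + 1) - 1 = n + u by omega, Nat.add_choose_eq,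
      Finset.Nat.sum_antidiagonal_eq_sum_range_succ (fun i j => n.choose i * u.choose j),
      Finset.sum_range_succ']
    simp only [Nat.sub_zero, Nat.choose_succ_self, mul_zero, add_zero]
    apply Finset.sum_congr rfl
    intro j hj
    have : j ≤ u := by simpa [Nat.lt_succ_iff] using hj
    rw [show u + 1 - (j + 1) = u - j by omega, Nat.choose_symm this, mul_comm]
  have h2 : Finset.range (u + 1) = {0, 1, 2} ∪ Finset.Icc 3 u := by
    ext x
    simp only [Finset.mem_range, Finset.mem_union, Finset.mem_insert, Finset.mem_singleton,
      Finset.mem_Icc]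
    omega
  have h3 : Disjoint ({0, 1, 2} : Finset ℕ) (Finset.Icc 3 u) := by
    rw [Finset.disjoint_left]
    intro x hx
    simp only [Finset.mem_insert, Finset.mem_singleton] at hx
    simp only [Finset.mem_Icc]
    omega
  rw [h1, h2, Finset.sum_union h3]
  simp
  ring

end PermTwo

/-- For `n ≥ 3` and `t > n`, the dimension of the degree-`t` component of the ideal
generated by the `2 × 2` sub-permanents of the generic `n × n` matrix. -/
theorem dim_permIdeal_two_component_high (n : ℕ) (hn : 3 ≤ n) (t : ℕ) (ht : n < t) :
    (Module.finrank ℂ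
        ↥(Submodule.restrictScalars ℂ (permIdeal n 2) ⊓
          homogeneousSubmodule (Fin n × Fin n) ℂ t) : ℤ) =
      ((n ^ 2 + t - 1).choose t : ℤ) -
        ((n : ℤ) ^ 2 +
          ((t : ℤ) - 1) * (((n ^ 2).choose 2 : ℤ) - (n.choose 2 : ℤ) ^ 2) +
          2 * ((t - 1).choose 2 : ℤ) * ((n.choose 2 : ℤ) ^ 2 + (n : ℤ) * (n.choose 3 : ℤ)) +
          2 * (n : ℤ) * ∑ j ∈ Finset.Icc 3 (t - 1), ((t - 1).choose j : ℤ) * (n.choose (j + 1) : ℤ)) := by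

  have h1 := PermTwo.finrank_main n t (by omega) ht
  have h2 := PermTwo.card_G n t (by omega)
  have h3 := PermTwo.vander n t hn ht
  have h4 : (((n ^ 2).choose 2 : ℕ) : ℤ) = 2 * n * n.choose 2 + 2 * (n.choose 2 : ℤ) ^ 2 := by
    have e1 : ((n.choose 2 : ℕ) : ℚ) = n * (n - 1) / 2 := Nat.cast_choose_two ℚ n
    have e2 : (((n ^ 2).choose 2 : ℕ) : ℚ) = (n ^ 2 : ℕ) * ((n ^ 2 : ℕ) - 1) / 2 :=
      Nat.cast_choose_two ℚ (n ^ 2)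
    have : (((n ^ 2).choose 2 : ℕ) : ℚ) = 2 * n * n.choose 2 + 2 * (n.choose 2 : ℚ) ^ 2 := by
      rw [e1, e2]; push_cast; ring
    exact_mod_cast this
  have h5 : (2 * ((t - 1).choose 2 : ℕ) : ℤ) = ((t : ℤ) - 1) * ((t : ℤ) - 2) := by
    have e1 : (((t - 1).choose 2 : ℕ) : ℚ) = ((t - 1 : ℕ) : ℚ) * ((t - 1 : ℕ) - 1) / 2 :=
      Nat.cast_choose_two ℚ (t - 1)
    rw [Nat.cast_sub (show 1 ≤ t by omega)] at e1
    have : (2 * ((t - 1).choose 2 : ℕ) : ℚ) = ((t : ℚ) - 1) * ((t : ℚ) - 2) := by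
      rw [e1]; push_cast; ring
    exact_mod_cast this
  have h1' : (Fintype.card (PermTwo.G n t) : ℤ) + (Module.finrank ℂ
        ↥(Submodule.restrictScalars ℂ (permIdeal n 2) ⊓
          homogeneousSubmodule (Fin n × Fin n) ℂ t) : ℤ) = ((n ^ 2 + t - 1).choose t : ℤ) := by
    exact_mod_cast h1
  rw [h3] at h2
  rw [h4]
  linear_combination h1' - h2 + (n.choose 2 : ℤ) ^ 2 * h5
end

section
/- Let 1 ≤ m ≤ n and let I(n,m) ⊆ ℂ[x_1,…,x_n] be the ideal generated by all square-free monomials of degree m (when m = n−κ these are the κ-th order partial derivatives of x_1⋯x_n). Then the dimension of the degree-t homogeneous component of the quotient ring ℂ[x_1,…,x_n]/I(n,m) equals Σ_{j=0}^{m−2} C(n, j+1) · C(t−1, j) for every integer t with t ≥ 1 and t ≥ m−1, and equals C(n+t−1, n−1) for every integer t with 0 ≤ t < m−1. -/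
open MvPolynomial

/-- The ideal of `ℂ[x_1,…,x_n]` generated by all square-free monomials of degree `m`. -/
noncomputable def squareFreeIdeal (n m : ℕ) : Ideal (MvPolynomial (Fin n) ℂ) :=
  Ideal.span {p | ∃ s : Finset (Fin n), s.card = m ∧ p = ∏ i ∈ s, X i}

noncomputable def sfInd {n : ℕ} (s : Finset (Fin n)) : Fin n →₀ ℕ :=
  Finsupp.equivFunOnFinite.symm (fun i => if i ∈ s then 1 else 0)

lemma sfInd_apply {n : ℕ} (s : Finset (Fin n)) (i : Fin n) :
    sfInd s i = if i ∈ s then 1 else 0 := rfl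

lemma sfInd_monomial {n : ℕ} (s : Finset (Fin n)) :
    (∏ i ∈ s, X i : MvPolynomial (Fin n) ℂ) = monomial (sfInd s) 1 := by
  rw [MvPolynomial.monomial_eq, Finsupp.prod_fintype _ _ (by simp)]
  simp [sfInd_apply, pow_ite, Finset.prod_ite_mem]

lemma mem_squareFreeIdeal_iff {n m : ℕ} (p : MvPolynomial (Fin n) ℂ) :
    p ∈ squareFreeIdeal n m ↔ ∀ d ∈ p.support, m ≤ d.support.card := by
  have : squareFreeIdeal n m = Ideal.span ((fun d => monomial d (1 : ℂ)) ''
      (sfInd '' {s : Finset (Fin n) | s.card = m})) := by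
    unfold squareFreeIdeal
    congr 1
    ext q
    constructor
    · rintro ⟨s, hs, rfl⟩
      exact ⟨_, ⟨s, hs, rfl⟩, (sfInd_monomial s).symm⟩
    · rintro ⟨_, ⟨s, hs, rfl⟩, rfl⟩
      exact ⟨s, hs, (sfInd_monomial s).symm⟩
  rw [this, mem_ideal_span_monomial_image]
  refine forall₂_congr fun d _ => ?_
  constructor
  · rintro ⟨_, ⟨s, hs, rfl⟩, hle⟩
    rw [← (show s.card = m from hs)]
    refine Finset.card_le_card fun i hi => ?_
    have := hle i
    simp only [sfInd_apply, hi, if_true] at this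
    simp only [Finsupp.mem_support_iff]
    omega
  · intro h
    obtain ⟨s, hs, hc⟩ := Finset.exists_subset_card_eq h
    refine ⟨_, ⟨s, hc, rfl⟩, fun i => ?_⟩
    rw [sfInd_apply]
    split_ifs with hi
    · have := hs hi
      simp only [Finsupp.mem_support_iff] at this
      omega
    · exact Nat.zero_le _

noncomputable def sfA (n m t : ℕ) : Finset (Fin n →₀ ℕ) :=
  (Finset.finsuppAntidiag Finset.univ t).filter (fun d => d.support.card < m)

lemma finrank_eq_card (n m t : ℕ) :
    Module.finrank ℂ
          (↥(homogeneousSubmodule (Fin n) ℂ t) ⧸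
            Submodule.comap (homogeneousSubmodule (Fin n) ℂ t).subtype
              (Submodule.restrictScalars ℂ (squareFreeIdeal n m))) = (sfA n m t).card := by
  let f : MvPolynomial (Fin n) ℂ →ₗ[ℂ] (sfA n m t → ℂ) :=
    LinearMap.pi (fun a => lcoeff ℂ a.1)
  have hf : ∀ p a, f p a = coeff a.1 p := fun _ _ => rfl
  let g := f.comp (homogeneousSubmodule (Fin n) ℂ t).subtype
  have hker : LinearMap.ker g = Submodule.comap (homogeneousSubmodule (Fin n) ℂ t).subtype
              (Submodule.restrictScalars ℂ (squareFreeIdeal n m)) := by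
    ext ⟨p, hp⟩
    simp only [LinearMap.mem_ker, Submodule.mem_comap, Submodule.restrictScalars_mem,
      Submodule.subtype_apply, mem_squareFreeIdeal_iff, funext_iff]
    constructor
    · intro h d hd
      by_contra hlt
      have hdeg := hp (mem_support_iff.1 hd)
      rw [Finsupp.weight_apply, Finsupp.sum_fintype _ _ (by simp)] at hdeg
      refine mem_support_iff.1 hd (h ⟨d, ?_⟩)
      simp only [sfA, Finset.mem_filter, Finset.mem_finsuppAntidiag]
      refine ⟨⟨by simpa using hdeg, Finset.subset_univ _⟩, by omega⟩
    · rintro h ⟨d, hd⟩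
      by_contra hne
      have := h d (mem_support_iff.2 hne)
      simp only [sfA, Finset.mem_filter] at hd
      omega
  have hsurj : Function.Surjective g := by
    intro v
    refine ⟨⟨∑ a, monomial a.1 (v a), ?_⟩, ?_⟩
    · refine Submodule.sum_mem _ fun a _ => ?_
      rw [mem_homogeneousSubmodule]
      apply isHomogeneous_monomial
      have := a.2
      simp only [sfA, Finset.mem_filter, Finset.mem_finsuppAntidiag] at this
      rw [Finsupp.degree_eq_sum]
      exact this.1.1
    · ext b
      change coeff b.1 (∑ a, monomial a.1 (v a)) = v b
      simp [coeff_sum, coeff_monomial]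
  rw [← hker, (g.quotKerEquivOfSurjective hsurj).finrank_eq]
  simp

lemma card_support_eq (n t : ℕ) (s : Finset (Fin n)) (hs : 1 ≤ s.card) (ht : 1 ≤ t) :
    ((Finset.finsuppAntidiag Finset.univ t).filter
      (fun d : Fin n →₀ ℕ => d.support = s)).card = (t - 1).choose (s.card - 1) := by
  have hge : ∀ d : Fin n →₀ ℕ, d.support = s → s.card ≤ ∑ i, d i := by
    rintro d rfl
    rw [Finset.card_eq_sum_ones]
    calc ∑ i ∈ d.support, 1 ≤ ∑ i ∈ d.support, d i :=
          Finset.sum_le_sum fun i hi => Nat.one_le_iff_ne_zero.2 (Finsupp.mem_support_iff.1 hi)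
      _ ≤ _ := Finset.sum_le_sum_of_subset (Finset.subset_univ _)
  rcases lt_or_ge t s.card with hlt | hle
  · rw [Nat.choose_eq_zero_of_lt (by omega), Finset.card_eq_zero, Finset.filter_eq_empty_iff]
    intro d hd hds
    have h1 := hge d hds
    have h2 : ∑ i, d i = t := (Finset.mem_finsuppAntidiag.1 hd).1
    omega
  · have hsum : ∑ i, sfInd s i = s.card := by simp [sfInd_apply]
    have : (Finset.finsuppAntidiag s (t - s.card)).card = (t - 1).choose (s.card - 1) := by
      rw [Finset.card_finsuppAntidiag_nat_eq_choose,
        show s.card + (t - s.card) - 1 = t - 1 by omega]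
      exact Nat.choose_symm_of_eq_add (by omega)
    rw [← this]
    symm
    refine Finset.card_bij' (fun d _ => d + sfInd s) (fun d _ => d - sfInd s) ?_ ?_ ?_ ?_
    · intro d hd
      rw [Finset.mem_finsuppAntidiag] at hd
      have hd1 : ∑ i, d i = t - s.card := by
        rw [← hd.1]
        symm
        apply Finset.sum_subset (Finset.subset_univ _)
        intro i _ hi
        by_contra h
        exact hi (hd.2 (Finsupp.mem_support_iff.2 h))
      rw [Finset.mem_filter, Finset.mem_finsuppAntidiag]
      refine ⟨⟨?_, Finset.subset_univ _⟩, ?_⟩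
      · change ∑ i, (d + sfInd s) i = t
        simp only [Finsupp.add_apply, Finset.sum_add_distrib, hsum, hd1]
        omega
      · ext i
        have := @hd.2 i
        simp only [Finsupp.mem_support_iff] at this
        simp only [Finsupp.mem_support_iff, Finsupp.add_apply, sfInd_apply]
        by_cases hi : i ∈ s
        · simp [hi]
        · simp only [hi, if_false, add_zero]; tauto
    · intro d hd
      rw [Finset.mem_filter, Finset.mem_finsuppAntidiag] at hd
      obtain ⟨⟨hd1, -⟩, hd2⟩ := hd
      have hz : ∀ i, i ∉ s → d i = 0 := by
        intro i hi; rw [← hd2] at hi; simpa using hi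
      rw [Finset.mem_finsuppAntidiag]
      constructor
      · have h1 : ∑ i ∈ s, d i = t := by
          rw [← hd1]
          exact Finset.sum_subset (Finset.subset_univ _) (fun i _ hi => hz i hi)
        have h2 : ∑ i ∈ s, (d - sfInd s) i + s.card = t := by
          rw [← h1, Finset.card_eq_sum_ones, ← Finset.sum_add_distrib]
          refine Finset.sum_congr rfl fun i hi => ?_
          have : d i ≠ 0 := by
            rw [← Finsupp.mem_support_iff, hd2]; exact hi
          simp only [Finsupp.tsub_apply, sfInd_apply, hi, if_true]
          omega
        change ∑ i ∈ s, (d - sfInd s) i = _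
        omega
      · intro i hi
        by_contra h
        simp [hz i h] at hi
    · intro d hd
      simp
    · intro d hd
      rw [Finset.mem_filter] at hd
      apply tsub_add_cancel_of_le
      intro i
      rw [sfInd_apply]
      split_ifs with hi
      · rw [← hd.2, Finsupp.mem_support_iff] at hi
        omega
      · exact Nat.zero_le _

lemma card_sfA (n m t : ℕ) (ht : 1 ≤ t) :
    (sfA n m t).card = ∑ j ∈ Finset.range (m - 1), n.choose (j + 1) * (t - 1).choose j := by
  have hpos : ∀ d ∈ sfA n m t, 1 ≤ d.support.card := by
    intro d hd
    simp only [sfA, Finset.mem_filter, Finset.mem_finsuppAntidiag] at hd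
    by_contra h
    have : d = 0 := by
      rw [← Finsupp.support_eq_empty, ← Finset.card_eq_zero]; omega
    subst this
    simp at hd
    omega
  rw [Finset.card_eq_sum_card_fiberwise (f := fun d => d.support.card - 1)
    (t := Finset.range (m - 1))]
  · refine Finset.sum_congr rfl fun j hj => ?_
    rw [Finset.mem_range] at hj
    rw [Finset.card_eq_sum_card_fiberwise (f := fun d => d.support)
      (t := Finset.powersetCard (j + 1) Finset.univ)]
    · have : n.choose (j + 1) = (Finset.powersetCard (j + 1) (Finset.univ : Finset (Fin n))).card := by
        simp
      rw [this, ← smul_eq_mul, ← Finset.sum_const]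
      refine Finset.sum_congr rfl fun s hs => ?_
      have hc := (Finset.mem_powersetCard.1 hs).2
      rw [show j = s.card - 1 by omega, ← card_support_eq n t s (by omega) ht]
      congr 1
      ext d
      simp only [sfA, Finset.mem_filter]
      constructor
      · rintro ⟨⟨⟨h1, h2⟩, h3⟩, h4⟩
        exact ⟨h1, h4⟩
      · rintro ⟨h1, rfl⟩
        exact ⟨⟨⟨h1, by omega⟩, rfl⟩, rfl⟩
    · intro d hd
      have hd' := Finset.mem_filter.1 hd
      have := hpos d hd'.1
      refine Finset.mem_coe.2 (Finset.mem_powersetCard.2 ⟨Finset.subset_univ _, ?_⟩)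
      have := hd'.2
      change d.support.card = j + 1
      omega
  · intro d hd
    have h1 := hpos d hd
    have h2 := (Finset.mem_filter.1 hd).2
    simp only [Finset.coe_range, Set.mem_Iio]
    omega

lemma card_sfA' (n m t : ℕ) (hn : 1 ≤ n) (ht : t < m) :
    (sfA n m t).card = (n + t - 1).choose (n - 1) := by
  have : sfA n m t = Finset.finsuppAntidiag Finset.univ t := by
    apply Finset.filter_true_of_mem
    intro d hd
    refine lt_of_le_of_lt ?_ ht
    rw [← (Finset.mem_finsuppAntidiag.1 hd).1, Finset.card_eq_sum_ones]
    calc ∑ i ∈ d.support, 1 ≤ ∑ i ∈ d.support, d i :=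
          Finset.sum_le_sum fun i hi => Nat.one_le_iff_ne_zero.2 (Finsupp.mem_support_iff.1 hi)
      _ ≤ _ := Finset.sum_le_sum_of_subset (Finset.subset_univ _)
  rw [this, Finset.card_finsuppAntidiag_nat_eq_choose, Finset.card_univ, Fintype.card_fin]
  exact Nat.choose_symm_of_eq_add (by omega)

/-- For `1 ≤ m ≤ n`, the dimension of the degree-`t` component of
`ℂ[x_1,…,x_n]/I(n,m)` equals `Σ_{j=0}^{m−2} C(n, j+1) · C(t−1, j)` when `t ≥ 1` and
`t ≥ m−1`, and equals `C(n+t−1, n−1)` when `0 ≤ t < m−1`. -/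
theorem dim_squareFreeIdeal_quotient_component (n m : ℕ) (h1 : 1 ≤ m) (h2 : m ≤ n) (t : ℕ) :
    (1 ≤ t → m - 1 ≤ t →
      Module.finrank ℂ
          (↥(homogeneousSubmodule (Fin n) ℂ t) ⧸
            Submodule.comap (homogeneousSubmodule (Fin n) ℂ t).subtype
              (Submodule.restrictScalars ℂ (squareFreeIdeal n m))) =
        ∑ j ∈ Finset.range (m - 1), n.choose (j + 1) * (t - 1).choose j) ∧
    (t < m - 1 →
      Module.finrank ℂ
          (↥(homogeneousSubmodule (Fin n) ℂ t) ⧸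
            Submodule.comap (homogeneousSubmodule (Fin n) ℂ t).subtype
              (Submodule.restrictScalars ℂ (squareFreeIdeal n m))) =
        (n + t - 1).choose (n - 1)) := by
  rw [finrank_eq_card]
  exact ⟨fun ht _ => card_sfA n m t ht, fun ht => card_sfA' n m t (by omega) (by omega)⟩
end
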